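/- arXiv:1306.3724 — 3 statements merged into one kernel-verified Lean document; each statement's English description precedes it below -/
import Mathlib

section
/- Let (S,Σ,μ) be an atomless probability space and T a nonempty topological space. Every subset X of L(S,T) that is compact and metrizable in the topology of pointwise convergence is contained in a sequentially compact set Y ⊆ L(S,T) that has the μ-fixed point property. -/
open MeasureTheory Topology Filter

/-- `pw E g f` is the decomposition `g_E f`: equal to `g` on `E` and to `f` off `E`. -/
noncomputable def pw {α β : Type*} (E : Set α) (g f : α → β) : α → β :=
  haveI := Classical.decPred (· ∈ E)
  E.piecewise g f

/-- A set of functions `F ⊆ L(S,T)` is decomposable if it is stable under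
decompositions along measurable sets. -/
def Decomposable {S T : Type*} [MeasurableSpace S] (F : Set (S → T)) : Prop :=
  ∀ f ∈ F, ∀ g ∈ F, ∀ E : Set S, MeasurableSet E → pw E g f ∈ F

/-- A measure is atomless if every measurable set of positive measure has a measurable
subset of strictly smaller positive measure. -/
def MeasureAtomless {S : Type*} [MeasurableSpace S] (μ : Measure S) : Prop :=
  ∀ E : Set S, MeasurableSet E → 0 < μ E →
    ∃ F : Set S, F ⊆ E ∧ MeasurableSet F ∧ 0 < μ F ∧ μ F < μ E

/-- `B : F ⇉ F` is a decomposable μ-sequentially closed-graphed mapping: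
the domain `F` and all values `B f` are decomposable, `B` is insensitive to
modifications on μ-null sets, `F` is sequentially closed (for the topology of
pointwise convergence) and `B` has a sequentially closed graph in `F × F`. -/
structure IsDecompSeqClosedGraph {S T : Type*} [MeasurableSpace S] [TopologicalSpace T]
    (μ : Measure S) (F : Set (S → T)) (B : (S → T) → Set (S → T)) : Prop where
  decomp_dom : Decomposable F
  maps_into : ∀ f ∈ F, B f ⊆ F
  decomp_val : ∀ f ∈ F, Decomposable (B f)
  null_modification : ∀ E : Set S, MeasurableSet E → μ E = 0 →
    ∀ f ∈ F, ∀ g ∈ B f, ∀ h ∈ F, pw E h g ∈ B f ∧ g ∈ B (pw E h f)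
  seqClosed_dom : IsSeqClosed F
  seqClosed_graph : ∀ (u v : ℕ → S → T) (f g : S → T),
    (∀ n, u n ∈ F) → (∀ n, v n ∈ B (u n)) →
    Tendsto u atTop (𝓝 f) → Tendsto v atTop (𝓝 g) →
    f ∈ F → g ∈ F → g ∈ B f

/-- `Y` has the μ-fixed point property: every decomposable μ-sequentially
closed-graphed mapping `B : F ⇉ F` with `Y ∩ F ≠ ∅` and `Y ∩ B f ≠ ∅` for all
`f ∈ Y ∩ F` has a fixed point in `Y ∩ F`. -/
def HasMuFixedPointProperty {S T : Type*} [MeasurableSpace S] [TopologicalSpace T]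
    (μ : Measure S) (Y : Set (S → T)) : Prop :=
  ∀ (F : Set (S → T)) (B : (S → T) → Set (S → T)),
    IsDecompSeqClosedGraph μ F B →
    (Y ∩ F).Nonempty →
    (∀ f ∈ Y ∩ F, (Y ∩ B f).Nonempty) →
    ∃ f ∈ Y ∩ F, f ∈ B f

section Scarf

variable {I U : Type*}

/-- A set `W` is dominant for the rankings `rk i` if no `u` is strictly above all of `W`
in every ranking. -/
def Dominant (rk : I → U → ℕ) (W : Finset U) : Prop :=
  ∀ u, ∃ i, ∀ x ∈ W, rk i u ≤ rk i x

lemma Dominant.mono {rk : I → U → ℕ} {T W : Finset U} (h : Dominant rk W) (hTW : T ⊆ W) :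
    Dominant rk T := fun u => (h u).imp fun _ hi x hx => hi x (hTW hx)

lemma Dominant.exists_argmin_eq {rk : I → U → ℕ} (inj : ∀ i, Function.Injective (rk i))
    {W : Finset U} (h : Dominant rk W) {a : I → U} (ha : ∀ i, a i ∈ W)
    (hmin : ∀ i, ∀ x ∈ W, rk i (a i) ≤ rk i x) {x : U} (hx : x ∈ W) : ∃ i, a i = x := by
  obtain ⟨i, hi⟩ := h x
  exact ⟨i, inj i (le_antisymm (hmin i x hx) (hi _ (ha i)))⟩

lemma exists_argmin (rk : I → U → ℕ) {W : Finset U} (hW : W.Nonempty) :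
    ∃ a : I → U, (∀ i, a i ∈ W) ∧ ∀ i, ∀ x ∈ W, rk i (a i) ≤ rk i x := by
  choose a ha hmin using fun i => W.exists_min_image (rk i) hW
  exact ⟨a, ha, hmin⟩

lemma dominant_insert_of_isMax [DecidableEq U] {rk : I → U → ℕ} {T : Finset U}
    (hT : Dominant rk T) {a : I → U}
    (ha : ∀ i, a i ∈ T) (hmin : ∀ i, ∀ x ∈ T, rk i (a i) ≤ rk i x) {k : I}
    (hk : ∀ y ∈ T, ∃ l ≠ k, a l = y) {x : U} (hx : ∀ l ≠ k, rk l (a l) < rk l x)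
    (hmax : ∀ v, (∀ l ≠ k, rk l (a l) < rk l v) → rk k v ≤ rk k x) :
    x ∉ T ∧ Dominant rk (insert x T) := by
  constructor
  · intro hxT
    obtain ⟨l, hl, rfl⟩ := hk x hxT
    exact lt_irrefl _ (hx l hl)
  · intro v
    by_cases hv : ∀ l ≠ k, rk l (a l) < rk l v
    · refine ⟨k, fun y hy => ?_⟩
      rcases Finset.mem_insert.1 hy with rfl | hy
      · exact hmax v hv
      · obtain ⟨l, hl⟩ := hT v
        by_cases hlk : l = k
        · exact hlk ▸ hl y hy
        · exact absurd (hl _ (ha l)) (not_le.2 (hv l hlk))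
    · push Not at hv
      obtain ⟨l, hl, hlv⟩ := hv
      refine ⟨l, fun y hy => ?_⟩
      rcases Finset.mem_insert.1 hy with rfl | hy
      · exact hlv.trans (hx l hl).le
      · exact hlv.trans (hmin l y hy)

lemma exists_isMax_of_dominant_insert [Fintype I] [DecidableEq U] {rk : I → U → ℕ}
    (inj : ∀ i, Function.Injective (rk i))
    {T : Finset U} (hcard : T.card + 1 = Fintype.card I) {a : I → U}
    (ha : ∀ i, a i ∈ T) (hmin : ∀ i, ∀ x ∈ T, rk i (a i) ≤ rk i x) {x : U} (hxT : x ∉ T)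
    (hdom : Dominant rk (insert x T)) :
    ∃ k, (∀ y ∈ T, ∃ l ≠ k, a l = y) ∧ (∀ l ≠ k, rk l (a l) < rk l x) ∧
      ∀ v, (∀ l ≠ k, rk l (a l) < rk l v) → rk k v ≤ rk k x := by
  obtain ⟨a', ha', hmin'⟩ := exists_argmin rk (Finset.insert_nonempty x T)
  have hsurj : Set.SurjOn a' (Finset.univ : Finset I) (insert x T : Finset U) := by
    intro y hy
    obtain ⟨i, hi⟩ := hdom.exists_argmin_eq inj ha' hmin' (Finset.mem_coe.1 hy)
    exact ⟨i, by simp, hi⟩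
  have hinj : Set.InjOn a' (Finset.univ : Finset I) :=
    Finset.injOn_of_surjOn_of_card_le a' (fun i _ => ha' i) hsurj
      (by rw [Finset.card_insert_of_notMem hxT, Finset.card_univ, hcard])
  have hinj' : Function.Injective a' := fun i j h => hinj (by simp) (by simp) h
  obtain ⟨k, -, hk⟩ := hsurj (Finset.mem_coe.2 (Finset.mem_insert_self x T))
  have hlt : ∀ l ≠ k, rk l (a l) < rk l x := by
    intro l hl
    have h1 : a' l ≠ x := fun h => hl (hinj' (h.trans hk.symm))
    have h2 : a' l ∈ T := (Finset.mem_insert.1 (ha' l)).resolve_left h1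
    refine (hmin l _ h2).trans_lt (lt_of_le_of_ne (hmin' l x (Finset.mem_insert_self x T)) ?_)
    exact fun h => h1 (inj l h)
  refine ⟨k, ?_, hlt, ?_⟩
  · intro y hy
    obtain ⟨l, -, hl⟩ := hsurj (Finset.mem_coe.2 (Finset.mem_insert_of_mem hy))
    refine ⟨l, ?_, ?_⟩
    · rintro rfl
      exact hxT (hk ▸ hl ▸ hy)
    · refine inj l (le_antisymm (hmin l y hy) ?_)
      rw [← hl]
      exact hmin' l _ (Finset.mem_insert_of_mem (ha l))
  · intro v hv
    obtain ⟨l, hl⟩ := hdom v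
    by_cases hlk : l = k
    · exact hlk ▸ hl x (Finset.mem_insert_self x T)
    · exact absurd (hl _ (Finset.mem_insert_of_mem (ha l))) (not_le.2 (hv l hlk))

lemma exists_pair_surjOn_erase [Fintype I] [DecidableEq I] {T : Finset U}
    (hcard : T.card + 1 = Fintype.card I) {a : I → U}
    (ha : ∀ i, a i ∈ T) (hsurj : ∀ y ∈ T, ∃ i, a i = y) :
    ∃ i j, i ≠ j ∧ a i = a j ∧ ∀ k, (∀ y ∈ T, ∃ l ≠ k, a l = y) ↔ k = i ∨ k = j := by
  obtain ⟨i, -, j, -, hij, haij⟩ := Finset.exists_ne_map_eq_of_card_lt_of_maps_to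
    (s := (Finset.univ : Finset I)) (t := T) (by rw [Finset.card_univ]; omega)
    (f := a) (fun i _ => ha i)
  refine ⟨i, j, hij, haij, fun k => ⟨fun hk => ?_, ?_⟩⟩
  · by_contra! hne
    have hinj : Set.InjOn a (Finset.univ.erase k : Finset I) := by
      refine Finset.injOn_of_surjOn_of_card_le (t := T) a (fun i _ => ha i) ?_ ?_
      · intro y hy
        obtain ⟨l, hl, rfl⟩ := hk y hy
        exact ⟨l, by simp [hl], rfl⟩
      · rw [Finset.card_erase_of_mem (Finset.mem_univ k), Finset.card_univ]; omega
    exact hij (hinj (by simp [hne.1.symm]) (by simp [hne.2.symm]) haij)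
  · rintro (rfl | rfl) y hy
    · obtain ⟨l, rfl⟩ := hsurj y hy
      by_cases h : l = k
      · subst h; exact ⟨j, hij.symm, haij.symm⟩
      · exact ⟨l, h, rfl⟩
    · obtain ⟨l, rfl⟩ := hsurj y hy
      by_cases h : l = k
      · subst h; exact ⟨i, hij, haij⟩
      · exact ⟨l, h, rfl⟩

lemma exists_isMax [Fintype U] {rk : I → U → ℕ} {a : I → U} {k : I}
    (hne : ∃ x, ∀ l ≠ k, rk l (a l) < rk l x) :
    ∃ x, (∀ l ≠ k, rk l (a l) < rk l x) ∧
      ∀ v, (∀ l ≠ k, rk l (a l) < rk l v) → rk k v ≤ rk k x := by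
  classical
  obtain ⟨x₀, hx₀⟩ := hne
  obtain ⟨x, hx, hmax⟩ :=
    (Finset.univ.filter fun x => ∀ l ≠ k, rk l (a l) < rk l x).exists_max_image
    (rk k) ⟨x₀, by simpa using hx₀⟩
  exact ⟨x, by simpa using hx, fun v hv => hmax v (by simpa using hv)⟩

/-- A dominant set that is one element short and does not consist of slack elements has exactly
two dominant one-element extensions. -/
lemma card_extensions_eq_two [Fintype I] [Fintype U] [DecidableEq U] {rk : I → U → ℕ}
    (inj : ∀ i, Function.Injective (rk i))
    {e : I → U} (htop : ∀ i j u, j ≠ i → u ∉ Set.range e → rk i u < rk i (e j))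
    {T : Finset U} (hcard : T.card + 1 = Fintype.card I) (hT : Dominant rk T)
    {y₀ : U} (hy₀ : y₀ ∈ T) (hy₀e : y₀ ∉ Set.range e) [DecidablePred (Dominant rk)] :
    (Finset.univ.filter fun W : Finset U =>
      (W.card = Fintype.card I ∧ Dominant rk W) ∧ T ⊆ W).card = 2 := by
  classical
  obtain ⟨a, ha, hmin⟩ := exists_argmin rk ⟨y₀, hy₀⟩
  obtain ⟨i, j, hij, haij, hP⟩ := exists_pair_surjOn_erase hcard ha
    (fun y hy => hT.exists_argmin_eq inj ha hmin hy)
  have hne : ∀ k, ∃ x, ∀ l ≠ k, rk l (a l) < rk l x := fun k =>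
    ⟨e k, fun l hl => (hmin l y₀ hy₀).trans_lt (htop l k y₀ hl.symm hy₀e)⟩
  obtain ⟨xi, hxi, hmi⟩ := exists_isMax (hne i)
  obtain ⟨xj, hxj, hmj⟩ := exists_isMax (hne j)
  obtain ⟨hxiT, hdi⟩ := dominant_insert_of_isMax hT ha hmin ((hP i).2 (Or.inl rfl)) hxi hmi
  obtain ⟨hxjT, hdj⟩ := dominant_insert_of_isMax hT ha hmin ((hP j).2 (Or.inr rfl)) hxj hmj
  have hxne : xi ≠ xj := by
    rintro rfl
    obtain ⟨l, hl⟩ := hT xi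
    by_cases h : l = i
    · exact absurd (hl _ (ha l)) (not_le.2 (hxj l (h ▸ hij)))
    · exact absurd (hl _ (ha l)) (not_le.2 (hxi l h))
  have hset : (Finset.univ.filter fun W : Finset U =>
      (W.card = Fintype.card I ∧ Dominant rk W) ∧ T ⊆ W) = {insert xi T, insert xj T} := by
    ext W
    simp only [Finset.mem_filter, Finset.mem_univ, true_and, Finset.mem_insert,
      Finset.mem_singleton]
    constructor
    · rintro ⟨⟨hWc, hWd⟩, hTW⟩
      obtain ⟨x, hx, rfl⟩ := (Finset.covBy_iff_exists_insert (s := T) (t := W)).1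
        (Finset.covBy_iff_card_sdiff_eq_one.2 ⟨hTW, by rw [Finset.card_sdiff_of_subset hTW]; omega⟩)
      obtain ⟨k, hk, hxk, hmk⟩ := exists_isMax_of_dominant_insert inj hcard ha hmin hx hWd
      rcases (hP k).1 hk with rfl | rfl
      · left
        rw [inj k (le_antisymm (hmi x hxk) (hmk xi hxi))]
      · right
        rw [inj k (le_antisymm (hmj x hxk) (hmk xj hxj))]
    · rintro (rfl | rfl)
      · exact ⟨⟨by rw [Finset.card_insert_of_notMem hxiT, hcard], hdi⟩, Finset.subset_insert _ _⟩
      · exact ⟨⟨by rw [Finset.card_insert_of_notMem hxjT, hcard], hdj⟩, Finset.subset_insert _ _⟩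
  rw [hset, Finset.card_pair]
  intro h
  have : xi ∈ insert xj T := h ▸ Finset.mem_insert_self xi T
  exact (Finset.mem_insert.1 this).elim hxne hxiT

/-- The set of all slack elements but one has exactly one dominant one-element extension. -/
lemma card_slack_extensions_eq_one [Fintype I] [DecidableEq I] [Fintype U] [DecidableEq U]
    {rk : I → U → ℕ} (inj : ∀ i, Function.Injective (rk i))
    {e : I → U} (he : Function.Injective e) (hbot : ∀ i u, rk i (e i) ≤ rk i u)
    (htop : ∀ i j u, j ≠ i → u ∉ Set.range e → rk i u < rk i (e j))
    (hV : ∃ u, u ∉ Set.range e) (i₀ : I) [DecidablePred (Dominant rk)] :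
    (Finset.univ.filter fun W : Finset U =>
      (W.card = Fintype.card I ∧ Dominant rk W) ∧
        (Finset.univ.erase i₀).image e ⊆ W).card = 1 := by
  obtain ⟨u₀, hu₀⟩ := hV
  have hlow : ∀ l u, u ≠ e l → rk l (e l) < rk l u := fun l u hu =>
    lt_of_le_of_ne (hbot l u) fun h => hu (inj l h).symm
  obtain ⟨x, hx, hmax⟩ := exists_isMax (rk := rk) (a := e) (k := i₀)
    ⟨u₀, fun l _ => hlow l u₀ fun h => hu₀ ⟨l, h.symm⟩⟩
  have hxe : ∀ l, x ≠ e l := by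
    intro l
    by_cases hl : l = i₀
    · rintro rfl
      subst hl
      have h1 := hmax u₀ (fun l' _ => hlow l' u₀ fun h => hu₀ ⟨l', h.symm⟩)
      have h2 := hlow l u₀ fun h => hu₀ ⟨l, h.symm⟩
      omega
    · rintro rfl
      exact lt_irrefl _ (hx l hl)
  rw [Finset.card_eq_one]
  refine ⟨insert x ((Finset.univ.erase i₀).image e), ?_⟩
  have hTc : ((Finset.univ.erase i₀).image e).card + 1 = Fintype.card I := by
    rw [Finset.card_image_of_injective _ he, Finset.card_erase_of_mem (Finset.mem_univ _),
      Finset.card_univ]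
    have : 0 < Fintype.card I := Fintype.card_pos_iff.2 ⟨i₀⟩
    omega
  have hxT : x ∉ (Finset.univ.erase i₀).image e := by
    simp only [Finset.mem_image, not_exists, not_and]
    exact fun l _ h => hxe l h.symm
  ext W
  simp only [Finset.mem_filter, Finset.mem_univ, true_and, Finset.mem_singleton]
  constructor
  · rintro ⟨⟨hWc, hWd⟩, hTW⟩
    obtain ⟨y, hy, rfl⟩ := (Finset.covBy_iff_exists_insert).1
      (Finset.covBy_iff_card_sdiff_eq_one.2 ⟨hTW, by rw [Finset.card_sdiff_of_subset hTW]; omega⟩)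
    have key : ∀ v, (∀ l ≠ i₀, v ≠ e l) → rk i₀ v ≤ rk i₀ y := by
      intro v hv
      obtain ⟨l, hl⟩ := hWd v
      by_cases hli : l = i₀
      · exact hli ▸ hl y (Finset.mem_insert_self _ _)
      · have := hl (e l) (Finset.mem_insert_of_mem
          (Finset.mem_image_of_mem e (by simp [hli])))
        exact absurd this (not_le.2 (hlow l v (hv l hli)))
    have hyl : ∀ l ≠ i₀, y ≠ e l := by
      rintro l hl rfl
      exact hy (Finset.mem_image_of_mem e (by simp [hl]))
    rw [inj i₀ (le_antisymm (hmax y fun l hl => hlow l y (hyl l hl))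
      (key x fun l _ => hxe l))]
  · rintro rfl
    refine ⟨⟨by rw [Finset.card_insert_of_notMem hxT, hTc], ?_⟩, Finset.subset_insert _ _⟩
    intro v
    by_cases hv : ∀ l ≠ i₀, rk l (e l) < rk l v
    · refine ⟨i₀, fun y hy => ?_⟩
      rcases Finset.mem_insert.1 hy with rfl | hy
      · exact hmax v hv
      · obtain ⟨l, hl, rfl⟩ := Finset.mem_image.1 hy
        refine (hmax v hv).trans (htop i₀ l x (by simpa using hl) ?_).le
        rintro ⟨l', rfl⟩
        exact hxe l' rfl
    · push Not at hv
      obtain ⟨l, hl, hlv⟩ := hv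
      exact ⟨l, fun y _ => hlv.trans (hbot l y)⟩

lemma even_card_erase_image_eq [Fintype I] [DecidableEq I] [DecidableEq U] {W : Finset U}
    (c : U → I) (i₀ : I)
    (hcard : W.card = Fintype.card I) (hW : W.image c ≠ Finset.univ) :
    Even (W.filter fun w => (W.erase w).image c = Finset.univ.erase i₀).card := by
  rcases (W.filter fun w => (W.erase w).image c = Finset.univ.erase i₀).eq_empty_or_nonempty
    with h | ⟨w, hw⟩
  · simp [h]
  have hinj : ∀ z ∈ W, (W.erase z).image c = Finset.univ.erase i₀ →
      Set.InjOn c (W.erase z : Finset U) := by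
    intro z hz h
    rw [← Finset.card_image_iff, h, Finset.card_erase_of_mem hz,
      Finset.card_erase_of_mem (Finset.mem_univ _), Finset.card_univ, hcard]
  obtain ⟨hwW, hw⟩ := Finset.mem_filter.1 hw
  have himg : W.image c = insert (c w) (Finset.univ.erase i₀) := by
    rw [← hw, ← Finset.image_insert, Finset.insert_erase hwW]
  have hc : c w ≠ i₀ := by
    intro h
    rw [h, Finset.insert_erase (Finset.mem_univ _)] at himg
    exact hW himg
  have : c w ∈ (W.erase w).image c := by rw [hw]; simp [hc]
  obtain ⟨w', hw', hcw⟩ := Finset.mem_image.1 this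
  obtain ⟨hne, hw'W⟩ := Finset.mem_erase.1 hw'
  have hw2 : (W.erase w').image c = Finset.univ.erase i₀ := by
    have h1 : W.image c = Finset.univ.erase i₀ := by
      rw [himg, Finset.insert_eq_of_mem (by simp [hc])]
    rw [← h1]
    refine le_antisymm (Finset.image_subset_image (Finset.erase_subset _ _)) ?_
    intro y hy
    obtain ⟨z, hz, rfl⟩ := Finset.mem_image.1 hy
    by_cases hzw : z = w'
    · subst hzw
      exact Finset.mem_image.2 ⟨w, by simp [hwW, hne.symm], hcw.symm⟩
    · exact Finset.mem_image_of_mem c (by simp [hz, hzw])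
  have hset : (W.filter fun w => (W.erase w).image c = Finset.univ.erase i₀) = {w, w'} := by
    ext z
    simp only [Finset.mem_filter, Finset.mem_insert, Finset.mem_singleton]
    constructor
    · rintro ⟨hz, hzc⟩
      by_contra! hzn
      exact hne (hinj z hz hzc (by simp [hw'W, hzn.2.symm]) (by simp [hwW, hzn.1.symm]) hcw)
    · rintro (rfl | rfl)
      · exact ⟨hwW, hw⟩
      · exact ⟨hw'W, hw2⟩
  rw [hset, Finset.card_pair hne.symm]
  exact even_two

/-- **Scarf's lemma**: there is a dominant set carrying all the colours. -/
theorem exists_dominant_image_eq_univ [Fintype I] [DecidableEq I] [Fintype U] [DecidableEq U]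
    [Nonempty I] {rk : I → U → ℕ}
    (inj : ∀ i, Function.Injective (rk i))
    {e : I → U} (he : Function.Injective e) (hbot : ∀ i u, rk i (e i) ≤ rk i u)
    (htop : ∀ i j u, j ≠ i → u ∉ Set.range e → rk i u < rk i (e j))
    (hV : ∃ u, u ∉ Set.range e) (c : U → I) (hc : ∀ i, c (e i) = i) :
    ∃ W : Finset U, Dominant rk W ∧ W.image c = Finset.univ := by
  classical
  by_contra! hno
  obtain ⟨i₀⟩ := ‹Nonempty I›
  set rooms : Finset (Finset U) :=
    Finset.univ.filter fun W => W.card = Fintype.card I ∧ Dominant rk W with hrooms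
  set doors : Finset (Finset U) :=
    Finset.univ.filter fun T => T.card + 1 = Fintype.card I ∧ Dominant rk T ∧
      T.image c = Finset.univ.erase i₀ with hdoors
  have hcount := Finset.sum_card_bipartiteAbove_eq_sum_card_bipartiteBelow
    (s := doors) (t := rooms) (fun T W => T ⊆ W)
  have hR : Even (∑ W ∈ rooms, (doors.bipartiteBelow (fun T W => T ⊆ W) W).card) := by
    refine Finset.even_sum _ fun W hW => ?_
    obtain ⟨-, hWc, hWd⟩ := Finset.mem_filter.1 hW
    have := even_card_erase_image_eq c i₀ hWc (hno W hWd)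
    suffices h : (W.filter fun w => (W.erase w).image c = Finset.univ.erase i₀).card =
        (doors.bipartiteBelow (fun T W => T ⊆ W) W).card from h ▸ this
    refine Finset.card_bij (fun w _ => W.erase w) ?_ ?_ ?_
    · intro w hw
      obtain ⟨hw, hwc⟩ := Finset.mem_filter.1 hw
      have hpos : 0 < W.card := Finset.card_pos.2 ⟨w, hw⟩
      simp only [Finset.bipartiteBelow, hdoors, Finset.mem_filter, Finset.mem_univ, true_and]
      refine ⟨⟨?_, hWd.mono (Finset.erase_subset _ _), hwc⟩, Finset.erase_subset _ _⟩
      rw [Finset.card_erase_of_mem hw]; omega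
    · intro w hw w' hw' h
      exact Finset.erase_injOn W (Finset.mem_coe.2 (Finset.mem_filter.1 hw).1)
        (Finset.mem_coe.2 (Finset.mem_filter.1 hw').1) h
    · intro T hT
      simp only [Finset.bipartiteBelow, hdoors, Finset.mem_filter, Finset.mem_univ,
        true_and] at hT
      obtain ⟨⟨hTc, -, hTi⟩, hTW⟩ := hT
      obtain ⟨w, hw, rfl⟩ := (Finset.covBy_iff_exists_insert).1
        (Finset.covBy_iff_card_sdiff_eq_one.2
          ⟨hTW, by rw [Finset.card_sdiff_of_subset hTW]; omega⟩)
      refine ⟨w, ?_, Finset.erase_insert hw⟩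
      rw [Finset.mem_filter, Finset.erase_insert hw]
      exact ⟨Finset.mem_insert_self _ _, hTi⟩
  set T₀ : Finset U := (Finset.univ.erase i₀).image e with hT₀
  have hT₀c : T₀.card + 1 = Fintype.card I := by
    rw [hT₀, Finset.card_image_of_injective _ he, Finset.card_erase_of_mem (Finset.mem_univ _),
      Finset.card_univ]
    have : 0 < Fintype.card I := Fintype.card_pos_iff.2 ⟨i₀⟩
    omega
  have habove : ∀ T, (rooms.bipartiteAbove (fun T W => T ⊆ W) T) =
      Finset.univ.filter fun W : Finset U =>
        (W.card = Fintype.card I ∧ Dominant rk W) ∧ T ⊆ W := by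
    intro T; ext W; simp [Finset.bipartiteAbove, hrooms]
  have hone := card_slack_extensions_eq_one inj he hbot htop hV i₀
  have hT₀d : T₀ ∈ doors := by
    obtain ⟨W, hW⟩ := Finset.card_pos.1 (hone ▸ Nat.one_pos)
    obtain ⟨-, ⟨-, hWd⟩, hTW⟩ := Finset.mem_filter.1 hW
    refine Finset.mem_filter.2 ⟨Finset.mem_univ _, hT₀c, hWd.mono hTW, ?_⟩
    rw [hT₀, Finset.image_image, show c ∘ e = id from funext hc, Finset.image_id]
  have hD : Odd (∑ T ∈ doors, (rooms.bipartiteAbove (fun T W => T ⊆ W) T).card) := by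
    rw [← Finset.add_sum_erase _ _ hT₀d, habove, hone]
    refine Even.one_add (Finset.even_sum _ fun T hT => ?_)
    obtain ⟨hTne, hT⟩ := Finset.mem_erase.1 hT
    obtain ⟨-, hTc, hTd, hTi⟩ := Finset.mem_filter.1 hT
    have : ∃ y ∈ T, y ∉ Set.range e := by
      by_contra! h
      refine hTne (Finset.eq_of_subset_of_card_le ?_ (by omega))
      intro y hy
      obtain ⟨i, rfl⟩ := h y hy
      have := Finset.mem_image_of_mem c hy
      rw [hTi, hc] at this
      exact Finset.mem_image_of_mem e this
    obtain ⟨y, hy, hye⟩ := this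
    rw [habove, card_extensions_eq_two inj htop hTc hTd hy hye]
    exact even_two
  rw [hcount] at hD
  exact (Nat.not_odd_iff_even.2 hR) hD

end Scarf

section Brouwer

variable {I : Type*} [Fintype I]

/-- The grid points of mesh `1 / N` in the standard simplex, scaled by `N`. -/
abbrev GridSimplex (I : Type*) [Fintype I] (N : ℕ) : Type _ :=
  {v : I → Fin (N + 1) // ∑ i, (v i : ℕ) = N}

/-- In a grid simplex of mesh `1 / N`, Scarf's lemma yields for any colouring a point all of whose
coordinates are small or close to a grid point of the corresponding colour. -/
lemma exists_grid_point [Nonempty I] (N : ℕ)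
    (c : GridSimplex I N → I) :
    ∃ x : GridSimplex I N, ∀ i,
      (x.1 i : ℕ) ≤ Fintype.card I ∨
      ∃ y : GridSimplex I N, c y = i ∧
        ∀ j, (x.1 j : ℕ) ≤ y.1 j + Fintype.card I ∧ (y.1 j : ℕ) ≤ x.1 j + Fintype.card I := by
  classical
  let V := GridSimplex I N
  set q := Fintype.card V with hq
  let enc : V ≃ Fin q := Fintype.equivFin V
  let idx : I ≃ Fin (Fintype.card I) := Fintype.equivFin I
  let rk : I → V ⊕ I → ℕ := fun i u => u.elim (fun v => 1 + (v.1 i : ℕ) * q + enc v)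
    (fun j => if j = i then 0 else 1 + (N + 1) * q + idx j)
  have hlt : ∀ i (v : V), 1 + (v.1 i : ℕ) * q + enc v < 1 + (N + 1) * q := by
    intro i v
    have h1 : (v.1 i : ℕ) ≤ N := Nat.lt_succ_iff.1 (v.1 i).2
    have h2 := (enc v).2
    nlinarith [Nat.mul_le_mul_right q h1]
  have hmono : ∀ i (v w : V), rk i (Sum.inl v) ≤ rk i (Sum.inl w) → (v.1 i : ℕ) ≤ w.1 i := by
    intro i v w h
    by_contra! hlt'
    have h2 := (enc w).2
    have h3 : ((w.1 i : ℕ) + 1) * q ≤ (v.1 i : ℕ) * q := Nat.mul_le_mul_right q hlt'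
    simp only [rk, Sum.elim_inl] at h
    nlinarith
  have inj : ∀ i, Function.Injective (rk i) := by
    rintro i (v | j) (w | k) h
    · have h1 : (v.1 i : ℕ) = w.1 i := le_antisymm (hmono i v w h.le) (hmono i w v h.ge)
      simp only [rk, Sum.elim_inl, h1] at h
      have hvw : v = w := enc.injective (Fin.ext (by omega))
      rw [hvw]
    · have := hlt i v
      simp only [rk, Sum.elim_inl, Sum.elim_inr] at h
      split_ifs at h <;> omega
    · have := hlt i w
      simp only [rk, Sum.elim_inl, Sum.elim_inr] at h
      split_ifs at h <;> omega
    · simp only [rk, Sum.elim_inr] at h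
      split_ifs at h with h1 h2 h2
      · rw [h1, h2]
      · omega
      · omega
      · have hjk : j = k := idx.injective (Fin.ext (by omega))
        rw [hjk]
  have hVne : Nonempty V := by
    obtain ⟨i₀⟩ := ‹Nonempty I›
    refine ⟨⟨fun i => if i = i₀ then Fin.last N else 0, ?_⟩⟩
    rw [Finset.sum_eq_single i₀] <;> simp +contextual
  obtain ⟨W, hWd, hWc⟩ := exists_dominant_image_eq_univ (rk := rk) inj (e := Sum.inr)
    Sum.inr_injective (fun i u => by simp [rk])
    (by
      rintro i j (v | k) hji hu
      · have := hlt i v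
        simp only [rk, Sum.elim_inl, Sum.elim_inr, if_neg hji]
        omega
      · exact absurd ⟨k, rfl⟩ hu)
    ⟨Sum.inl hVne.some, by simp⟩ (Sum.elim c id) (fun i => rfl)
  have hcol : ∀ i, Sum.inr i ∉ W → ∃ y, Sum.inl y ∈ W ∧ c y = i := by
    intro i hi
    obtain ⟨u, hu, hui⟩ := Finset.mem_image.1 (hWc ▸ Finset.mem_univ i)
    rcases u with y | j
    · exact ⟨y, hu, hui⟩
    · simp only [Sum.elim_inr, id] at hui
      exact absurd (hui ▸ hu) hi
  have hdom : ∀ v : V, ∃ i, Sum.inr i ∉ W ∧ ∀ x, Sum.inl x ∈ W → (v.1 i : ℕ) ≤ x.1 i := by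
    intro v
    obtain ⟨i, hi⟩ := hWd (Sum.inl v)
    refine ⟨i, fun h => ?_, fun x hx => hmono i v x (hi _ hx)⟩
    have := hi _ h
    simp [rk] at this
  obtain ⟨i₁, hi₁, -⟩ := hdom hVne.some
  obtain ⟨x, hxW, -⟩ := hcol i₁ hi₁
  have hargmin : ∀ i, ∃ y, Sum.inl y ∈ W ∧ ∀ z, Sum.inl z ∈ W → (y.1 i : ℕ) ≤ z.1 i := by
    intro i
    obtain ⟨y, hy, hmin⟩ := (Finset.univ.filter fun y : V => Sum.inl y ∈ W).exists_min_image
      (fun y => (y.1 i : ℕ)) ⟨x, by simpa using hxW⟩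
    exact ⟨y, by simpa using hy, fun z hz => hmin z (by simpa using hz)⟩
  choose a haW hamin using hargmin
  let m : I → ℕ := fun i => if Sum.inr i ∈ W then 0 else (a i).1 i
  have hm_le : ∀ y, Sum.inl y ∈ W → ∀ i, m i ≤ y.1 i := by
    intro y hy i
    simp only [m]
    split_ifs
    · exact Nat.zero_le _
    · exact hamin i y hy
  have hsum : N < ∑ i, (m i + 1) := by
    by_contra! hle
    obtain ⟨i₀⟩ := ‹Nonempty I›
    set v : I → ℕ := fun i => m i + 1 + if i = i₀ then N - ∑ i, (m i + 1) else 0 with hv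
    have hvs : ∑ i, v i = N := by
      simp only [hv]
      rw [Finset.sum_add_distrib, Finset.sum_ite_eq' Finset.univ i₀, if_pos (Finset.mem_univ _)]
      omega
    have hvN : ∀ i, v i < N + 1 := fun i => Nat.lt_succ_iff.2
      (hvs ▸ Finset.single_le_sum (fun _ _ => Nat.zero_le _) (Finset.mem_univ i))
    obtain ⟨i, hi, hvi⟩ := hdom ⟨fun i => ⟨v i, hvN i⟩, hvs⟩
    have h1 : v i ≤ (a i).1 i := hvi _ (haW i)
    have h2 : m i = (a i).1 i := if_neg hi
    have h3 : m i + 1 ≤ v i := Nat.le_add_right _ _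
    omega
  have hle : ∀ y, Sum.inl y ∈ W → ∀ i, (y.1 i : ℕ) ≤ m i + Fintype.card I := by
    intro y hy i
    have h1 : ((y.1 i : ℕ) - m i) ≤ ∑ j, ((y.1 j : ℕ) - m j) :=
      Finset.single_le_sum (f := fun j => (y.1 j : ℕ) - m j) (fun _ _ => Nat.zero_le _)
        (Finset.mem_univ i)
    have h2 : ∑ j, ((y.1 j : ℕ) - m j) + ∑ j, m j = N := by
      rw [← Finset.sum_add_distrib]
      exact (Finset.sum_congr rfl fun j _ => Nat.sub_add_cancel (hm_le y hy j)).trans y.2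
    rw [Finset.sum_add_distrib, Finset.sum_const, Finset.card_univ, smul_eq_mul, mul_one] at hsum
    omega
  refine ⟨x, fun i => ?_⟩
  by_cases hi : Sum.inr i ∈ W
  · left
    have := hle x hxW i
    rwa [show m i = 0 from if_pos hi, zero_add] at this
  · right
    obtain ⟨y, hy, hyc⟩ := hcol i hi
    refine ⟨y, hyc, fun j => ⟨?_, ?_⟩⟩
    · exact (hle x hxW j).trans (Nat.add_le_add_right (hm_le y hy j) _)
    · exact (hle y hy j).trans (Nat.add_le_add_right (hm_le x hxW j) _)

lemma exists_approx_fixed_point [Nonempty I] {f : (I → ℝ) → I → ℝ}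
    (hmaps : Set.MapsTo f (stdSimplex ℝ I) (stdSimplex ℝ I)) (N : ℕ) :
    ∃ z ∈ stdSimplex ℝ I, ∀ i, ∃ z' ∈ stdSimplex ℝ I,
      (∀ j, |z' j - z j| ≤ Fintype.card I / (N + 1 : ℝ)) ∧
        z' i ≤ f z' i + Fintype.card I / (N + 1 : ℝ) := by
  have hN : (0 : ℝ) < N + 1 := by positivity
  let p : GridSimplex I (N + 1) → I → ℝ :=
    fun v i => (v.1 i : ℕ) / (N + 1 : ℝ)
  have hp : ∀ v, p v ∈ stdSimplex ℝ I := by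
    intro v
    refine ⟨fun i => by positivity, ?_⟩
    simp only [p]
    rw [← Finset.sum_div, div_eq_one_iff_eq hN.ne']
    exact_mod_cast congrArg (Nat.cast (R := ℝ)) v.2
  have hcol : ∀ v, ∃ i, p v i ≤ f (p v) i := by
    intro v
    by_contra! h
    have := Finset.sum_lt_sum_of_nonempty Finset.univ_nonempty fun i _ => h i
    rw [(hp v).2, (hmaps (hp v)).2] at this
    exact lt_irrefl _ this
  choose c hc using hcol
  obtain ⟨x, hx⟩ := exists_grid_point (N + 1) c
  refine ⟨p x, hp x, fun i => ?_⟩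
  rcases hx i with h | ⟨y, rfl, hy⟩
  · refine ⟨p x, hp x, fun j => by rw [sub_self, abs_zero]; positivity, ?_⟩
    have h1 : p x i ≤ Fintype.card I / (N + 1 : ℝ) := by
      simp only [p]
      gcongr
    linarith [(hmaps (hp x)).1 i]
  · refine ⟨p y, hp y, fun j => ?_, ?_⟩
    · simp only [p]
      rw [← sub_div, abs_div, abs_of_pos hN]
      gcongr
      obtain ⟨h1, h2⟩ := hy j
      have h1' : ((x.1 j : ℕ) : ℝ) ≤ (y.1 j : ℕ) + Fintype.card I := by exact_mod_cast h1
      have h2' : ((y.1 j : ℕ) : ℝ) ≤ (x.1 j : ℕ) + Fintype.card I := by exact_mod_cast h2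
      rw [abs_le]
      constructor <;> linarith
    · have : (0 : ℝ) ≤ Fintype.card I / (N + 1 : ℝ) := by positivity
      linarith [hc y]

/-- **Brouwer's fixed point theorem** for the standard simplex. -/
theorem exists_fixed_point_stdSimplex [Nonempty I] {f : (I → ℝ) → I → ℝ}
    (hf : ContinuousOn f (stdSimplex ℝ I))
    (hmaps : Set.MapsTo f (stdSimplex ℝ I) (stdSimplex ℝ I)) :
    ∃ x ∈ stdSimplex ℝ I, f x = x := by
  choose z hz z' hz' hdist hle using fun N : ℕ => exists_approx_fixed_point hmaps N
  obtain ⟨x, hx, φ, hφ, hlim⟩ := (isCompact_stdSimplex ℝ I).tendsto_subseq hz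
  have hsmall : Tendsto (fun n => (Fintype.card I : ℝ) / (φ n + 1 : ℝ)) atTop (𝓝 0) :=
    (tendsto_const_div_atTop_nhds_zero_nat (Fintype.card I : ℝ) |>.comp
      (tendsto_add_atTop_nat 1) |>.comp hφ.tendsto_atTop).congr fun n => by simp
  have hlim' : ∀ i, Tendsto (fun n => z' (φ n) i) atTop (𝓝 x) := by
    intro i
    rw [tendsto_pi_nhds] at hlim ⊢
    intro j
    have h0 : Tendsto (fun n => z' (φ n) i j - z (φ n) j) atTop (𝓝 0) :=
      squeeze_zero_norm (fun n => hdist (φ n) i j) hsmall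
    simpa using h0.add (hlim j)
  have hge : ∀ i, x i ≤ f x i := by
    intro i
    have h1 : Tendsto (fun n => f (z' (φ n) i)) atTop (𝓝 (f x)) :=
      (hf x hx).tendsto.comp (tendsto_nhdsWithin_iff.2
        ⟨hlim' i, Eventually.of_forall fun n => hz' (φ n) i⟩)
    have h2 := (tendsto_pi_nhds.1 h1 i).add hsmall
    rw [add_zero] at h2
    exact le_of_tendsto_of_tendsto' (tendsto_pi_nhds.1 (hlim' i) i) h2 fun n => hle (φ n) i
  refine ⟨x, hx, funext fun i => ?_⟩
  have := (Finset.sum_eq_sum_iff_of_le (s := Finset.univ) fun i _ => hge i).1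
    (by rw [hx.2, (hmaps hx).2])
  exact (this i (Finset.mem_univ i)).symm

end Brouwer

section Uniform

variable {S : Type*} [MeasurableSpace S] {μ : Measure S}

/-- `E` is contained in `F` and has strictly smaller measure. -/
def MeasureSSubset (μ : Measure S) (E F : Set S) : Prop := E ⊆ F ∧ μ E < μ F

lemma IsChain.subset_total {D : Set (Set S)} (hD : IsChain (MeasureSSubset μ) D) {E F : Set S}
    (hE : E ∈ D) (hF : F ∈ D) : E ⊆ F ∨ F ⊆ E := by
  rcases eq_or_ne E F with rfl | hne
  · exact Or.inl subset_rfl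
  · exact (hD hE hF hne).imp And.left And.left

/-- A chain of measurable sets has a measurable supremum. -/
lemma exists_measurable_sup_of_isChain {D : Set (Set S)} (hmeas : ∀ E ∈ D, MeasurableSet E)
    (hD : IsChain (MeasureSSubset μ) D) {x : ENNReal} (hx : ∀ E ∈ D, μ E ≤ x) :
    ∃ U, MeasurableSet U ∧ (∀ E ∈ D, E ⊆ U) ∧ μ U ≤ x ∧ ∀ F, (∀ E ∈ D, E ⊆ F) → U ⊆ F := by
  rcases D.eq_empty_or_nonempty with rfl | hne
  · exact ⟨∅, MeasurableSet.empty, by simp, by simp, fun F _ => Set.empty_subset F⟩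
  by_cases hmax : ∃ U ∈ D, ∀ E ∈ D, E ⊆ U
  · obtain ⟨U, hU, hUmax⟩ := hmax
    exact ⟨U, hmeas U hU, hUmax, hx U hU, fun F hF => hF U hU⟩
  push Not at hmax
  obtain ⟨t, -, ht, htD⟩ := exists_seq_tendsto_sSup (hne.image μ) (OrderTop.bddAbove _)
  choose u huD hut using htD
  refine ⟨⋃ n, u n, MeasurableSet.iUnion fun n => hmeas _ (huD n), fun E hE => ?_, ?_,
    fun F hF => Set.iUnion_subset fun n => hF _ (huD n)⟩
  · by_contra hcon
    have hle : ∀ n, u n ⊆ E := fun n => ((hD.subset_total (huD n) hE).resolve_right fun h =>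
      hcon (h.trans (Set.subset_iUnion u n)))
    have hsup : sSup (μ '' D) ≤ μ E :=
      le_of_tendsto' ht fun n => hut n ▸ measure_mono (hle n)
    obtain ⟨F, hF, hFE⟩ := hmax E hE
    rcases hD hE hF (by rintro rfl; exact hFE subset_rfl) with h | h
    · exact (h.2.trans_le ((le_sSup (Set.mem_image_of_mem μ hF)).trans hsup)).false
    · exact hFE h.1
  · rw [Directed.measure_iUnion]
    · exact iSup_le fun n => hx _ (huD n)
    · intro i j
      rcases hD.subset_total (huD i) (huD j) with h | h
      · exact ⟨j, h, subset_rfl⟩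
      · exact ⟨i, subset_rfl, h⟩

/-- In an atomless probability space there is an increasing family of measurable sets attaining
every measure. -/
lemma MeasureAtomless.exists_monotone [IsProbabilityMeasure μ] (hμ : MeasureAtomless μ) :
    ∃ E : unitInterval → Set S, Monotone E ∧ (∀ t, MeasurableSet (E t)) ∧
      ∀ t, μ (E t) = ENNReal.ofReal t := by
  have hspec := maxChain_spec (α := {E : Set S // MeasurableSet E})
    (r := fun E F => MeasureSSubset μ E.1 F.1)
  set C' := maxChain (α := {E : Set S // MeasurableSet E}) fun E F => MeasureSSubset μ E.1 F.1
  set C : Set (Set S) := Subtype.val '' C' with hCdef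
  have hmeas : ∀ E ∈ C, MeasurableSet E := by
    rintro _ ⟨E, -, rfl⟩
    exact E.2
  have hC : IsChain (MeasureSSubset μ) C := by
    rintro _ ⟨E, hE, rfl⟩ _ ⟨F, hF, rfl⟩ hne
    exact hspec.1 hE hF (by rintro rfl; exact hne rfl)
  have hmax : ∀ M, MeasurableSet M →
      ¬ ∀ F ∈ C, MeasureSSubset μ F M ∨ MeasureSSubset μ M F := by
    intro M hM h
    have hins : IsChain _ (insert (⟨M, hM⟩ : {E : Set S // MeasurableSet E}) C') :=
      hspec.1.insert fun F hF _ => (h F.1 ⟨F, hF, rfl⟩).symm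
    have hMC : (⟨M, hM⟩ : {E : Set S // MeasurableSet E}) ∈ C' := by
      rw [hspec.2 hins (Set.subset_insert _ _)]
      exact Set.mem_insert _ _
    rcases h M ⟨_, hMC, rfl⟩ with h | h <;> exact lt_irrefl _ h.2
  have hsub : ∀ E ∈ C, ∀ F ∈ C, μ E < μ F → E ⊆ F := by
    intro E hE F hF hlt
    rcases hC.subset_total hE hF with h | h
    · exact h
    · exact absurd (measure_mono h) (not_le.2 hlt)
  have hex : ∀ x ≤ (1 : ENNReal), ∃ E ∈ C, μ E = x := by
    intro x hx1
    by_contra! hx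
    obtain ⟨U, hU, hUE, hUx, hUF⟩ := exists_measurable_sup_of_isChain
      (D := {E ∈ C | μ E < x}) (fun E hE => hmeas E hE.1) (hC.mono fun E hE => hE.1)
      (fun E hE => hE.2.le)
    obtain ⟨W, hW, hWE, hWx, hWF⟩ := exists_measurable_sup_of_isChain
      (μ := μ) (D := compl '' {E ∈ C | x < μ E}) (x := 1 - x)
      (by rintro _ ⟨E, hE, rfl⟩; exact (hmeas E hE.1).compl)
      (by
        rintro _ ⟨E, hE, rfl⟩ _ ⟨F, hF, rfl⟩ hne
        refine (hC hF.1 hE.1 (by rintro rfl; exact hne rfl)).imp ?_ ?_ <;>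
        · rintro ⟨h1, h2⟩
          refine ⟨Set.compl_subset_compl.2 h1, ?_⟩
          rw [prob_compl_eq_one_sub (hmeas _ hF.1), prob_compl_eq_one_sub (hmeas _ hE.1)]
          rw [lt_tsub_iff_right]
          refine (ENNReal.add_lt_add_left
            (ENNReal.sub_ne_top ENNReal.one_ne_top) h2).trans_eq ?_
          exact tsub_add_cancel_of_le prob_le_one)
      (by
        rintro _ ⟨E, hE, rfl⟩
        rw [prob_compl_eq_one_sub (hmeas _ hE.1)]
        exact tsub_le_tsub_left hE.2.le _)
    have hVx : x ≤ μ Wᶜ := by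
      rw [prob_compl_eq_one_sub hW]
      calc x = 1 - (1 - x) := (ENNReal.sub_sub_cancel ENNReal.one_ne_top hx1).symm
        _ ≤ 1 - μ W := tsub_le_tsub_left hWx _
    have hVF : ∀ F ∈ C, x < μ F → Wᶜ ⊆ F := fun F hF hxF =>
      Set.compl_subset_comm.1 (hWE _ ⟨F, ⟨hF, hxF⟩, rfl⟩)
    have hUV : U ⊆ Wᶜ := Set.subset_compl_comm.1 (hWF _ (by
      rintro _ ⟨F, hF, rfl⟩
      exact Set.compl_subset_compl.2 (hUF _ fun E hE => hsub E hE.1 F hF.1 (hE.2.trans hF.2))))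
    rcases (hUx.trans hVx).lt_or_eq with hlt | heq
    · have hdiff : 0 < μ (Wᶜ \ U) := by
        rw [measure_sdiff hUV hU.nullMeasurableSet (measure_ne_top μ U)]
        exact tsub_pos_of_lt hlt
      obtain ⟨G, hGsub, hG, hG0, hGlt⟩ := hμ _ (hW.compl.diff hU) hdiff
      have hM : μ (U ∪ G) = μ U + μ G :=
        measure_union (Set.disjoint_sdiff_right.mono_right hGsub) hG
      have hUM : μ U < μ (U ∪ G) := by
        rw [hM]
        exact ENNReal.lt_add_right (measure_ne_top μ U) hG0.ne'
      have hMV : μ (U ∪ G) < μ Wᶜ := by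
        rw [hM]
        calc μ U + μ G < μ U + μ (Wᶜ \ U) := ENNReal.add_lt_add_left (measure_ne_top μ U) hGlt
          _ = μ Wᶜ := measure_add_sdiff hU.nullMeasurableSet _ ▸ by
            rw [Set.union_eq_self_of_subset_left hUV]
      refine hmax _ (hU.union hG) fun F hF => ?_
      rcases (hx F hF).lt_or_gt with h | h
      · have hFU : F ⊆ U := hUE F ⟨hF, h⟩
        exact Or.inl ⟨hFU.trans Set.subset_union_left, (measure_mono hFU).trans_lt hUM⟩
      · have hVF' := hVF F hF h
        exact Or.inr ⟨(Set.union_subset hUV (hGsub.trans Set.sdiff_subset)).trans hVF',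
          hMV.trans_le (measure_mono hVF')⟩
    · have hUx' : μ U = x := le_antisymm hUx (heq ▸ hVx)
      refine hmax _ hU fun F hF => ?_
      rcases (hx F hF).lt_or_gt with h | h
      · exact Or.inl ⟨hUE F ⟨hF, h⟩, hUx'.symm ▸ h⟩
      · exact Or.inr ⟨hUV.trans (hVF F hF h), hUx'.symm ▸ h⟩
  choose E hEC hE using fun t : unitInterval =>
    hex (ENNReal.ofReal t) (ENNReal.ofReal_le_one.2 t.2.2)
  refine ⟨E, fun s t hst => ?_, fun t => hmeas _ (hEC t), hE⟩
  rcases hst.eq_or_lt with rfl | hlt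
  · exact subset_rfl
  · refine hsub _ (hEC s) _ (hEC t) ?_
    rw [hE, hE]
    exact (ENNReal.ofReal_lt_ofReal_iff_of_nonneg s.2.1).2 hlt

/-- An atomless probability space carries a random variable which is uniformly distributed on the
unit interval. -/
lemma MeasureAtomless.exists_uniform [IsProbabilityMeasure μ] (hμ : MeasureAtomless μ) :
    ∃ P : S → ℝ, Measurable P ∧ μ.map P = volume.restrict (Set.Icc 0 1) := by
  obtain ⟨E, hmono, hmeas, hE⟩ := hμ.exists_monotone
  let P : S → ℝ := fun s => sInf (insert 1 {x : ℝ | ∃ t : unitInterval, (t : ℝ) = x ∧ s ∈ E t})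
  have hbdd : ∀ s, 0 ∈
      lowerBounds (insert 1 {x : ℝ | ∃ t : unitInterval, (t : ℝ) = x ∧ s ∈ E t}) := by
    rintro s x (rfl | ⟨t, rfl, -⟩)
    · exact zero_le_one
    · exact t.2.1
  have hP0 : ∀ s, 0 ≤ P s := fun s => le_csInf ⟨1, Set.mem_insert _ _⟩ (hbdd s)
  have hP1 : ∀ s, P s ≤ 1 := fun s => csInf_le ⟨0, hbdd s⟩ (Set.mem_insert _ _)
  have hPlt : ∀ x ≤ (1 : ℝ), {s | P s < x} =
      ⋃ t : {t : unitInterval // (t : ℝ) < x}, E t := by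
    intro x hx
    ext s
    simp only [Set.mem_ofPred_eq, Set.mem_iUnion, P]
    rw [csInf_lt_iff ⟨0, hbdd s⟩ ⟨1, Set.mem_insert _ _⟩]
    constructor
    · rintro ⟨y, rfl | ⟨t, rfl, hst⟩, hy⟩
      · exact absurd hx (not_le.2 hy)
      · exact ⟨⟨t, hy⟩, hst⟩
    · rintro ⟨⟨t, ht⟩, hst⟩
      exact ⟨t, Or.inr ⟨t, rfl, hst⟩, ht⟩
  have hPlt' : ∀ x ≤ (1 : ℝ), MeasurableSet {s | P s < x} ∧
      μ {s | P s < x} = ENNReal.ofReal x := by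
    intro x hx
    rcases le_or_gt x 0 with hx0 | hx0
    · have : {s | P s < x} = ∅ :=
        Set.eq_empty_of_forall_notMem fun s hs => (hx0.trans (hP0 s)).not_gt hs
      rw [this, measure_empty, ENNReal.ofReal_of_nonpos hx0]
      exact ⟨MeasurableSet.empty, rfl⟩
    obtain ⟨u, hu, hux, hlim⟩ := exists_seq_strictMono_tendsto' hx0
    let t : ℕ → unitInterval := fun n => ⟨u n, (hux n).1.le, (hux n).2.le.trans hx⟩
    have hUnion : {s | P s < x} = ⋃ n, E (t n) := by
      rw [hPlt x hx]
      refine subset_antisymm (Set.iUnion_subset fun r => ?_) (Set.iUnion_subset fun n => ?_)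
      · obtain ⟨n, hn⟩ := (hlim.eventually_const_lt r.2).exists
        exact Set.subset_iUnion_of_subset n (hmono hn.le)
      · exact Set.subset_iUnion_of_subset ⟨t n, (hux n).2⟩ subset_rfl
    rw [hUnion]
    refine ⟨MeasurableSet.iUnion fun n => hmeas _, tendsto_nhds_unique
      (tendsto_measure_iUnion_atTop fun m n hmn => hmono (hu.monotone hmn)) ?_⟩
    simp only [Function.comp_def, hE]
    exact ENNReal.tendsto_ofReal hlim
  have hPm : Measurable P := by
    refine measurable_of_Iio fun x => ?_
    rcases le_or_gt x 1 with hx | hx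
    · exact (hPlt' x hx).1
    · convert MeasurableSet.univ
      exact Set.eq_univ_of_forall fun s => (hP1 s).trans_lt hx
  refine ⟨P, hPm, ?_⟩
  have : IsProbabilityMeasure (μ.map P) := Measure.isProbabilityMeasure_map hPm.aemeasurable
  refine Measure.ext_of_Ici _ _ fun x => ?_
  rw [Measure.map_apply hPm measurableSet_Ici, Measure.restrict_apply measurableSet_Ici]
  have hcompl : P ⁻¹' Set.Ici x = {s | P s < x}ᶜ := by
    ext s
    simp
  rcases le_or_gt x 1 with hx | hx
  · rw [hcompl, prob_compl_eq_one_sub (hPlt' x hx).1, (hPlt' x hx).2]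
    rcases le_total x 0 with hx0 | hx0
    · rw [ENNReal.ofReal_of_nonpos hx0, Set.inter_eq_right.2]
      · simp
      · exact fun y hy => hx0.trans hy.1
    · have : Set.Ici x ∩ Set.Icc 0 1 = Set.Icc x 1 := by
        ext y
        simp only [Set.mem_inter_iff, Set.mem_Ici, Set.mem_Icc]
        constructor
        · rintro ⟨h1, -, h2⟩
          exact ⟨h1, h2⟩
        · rintro ⟨h1, h2⟩
          exact ⟨h1, hx0.trans h1, h2⟩
      rw [this, Real.volume_Icc, ENNReal.ofReal_sub _ hx0, ENNReal.ofReal_one]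
  · have h1 : P ⁻¹' Set.Ici x = ∅ :=
      Set.eq_empty_of_forall_notMem fun s hs => ((hP1 s).trans_lt hx).not_ge hs
    have h2 : Set.Ici x ∩ Set.Icc 0 1 = ∅ :=
      Set.eq_empty_of_forall_notMem fun y hy => (hy.2.2.trans_lt hx).not_ge hy.1
    rw [h1, h2, measure_empty, measure_empty]

end Uniform

section Helly

lemma IsCompact.exists_subseq_tendsto_pi {J : Type*} [Countable J] {K : Set ℝ} (hK : IsCompact K)
    (u : ℕ → J → ℝ) (hu : ∀ n j, u n j ∈ K) :
    ∃ φ : ℕ → ℕ, StrictMono φ ∧ ∃ w : J → ℝ, ∀ j, Tendsto (fun n => u (φ n) j) atTop (𝓝 (w j)) := by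
  obtain ⟨w, -, φ, hφ, hlim⟩ := (isCompact_univ_pi fun _ : J => hK).tendsto_subseq
    (x := u) fun n j _ => hu n j
  exact ⟨φ, hφ, w, tendsto_pi_nhds.1 hlim⟩

/-- If monotone functions converge at all rational points, then they converge outside of a
countable set. -/
lemma exists_countable_forall_tendsto {u : ℕ → ℝ → ℝ} (hu : ∀ n, Monotone (u n)) {w : ℚ → ℝ}
    (hw : ∀ q : ℚ, Tendsto (fun n => u n q) atTop (𝓝 (w q))) :
    ∃ D : Set ℝ, D.Countable ∧ ∀ x ∉ D, ∃ l, Tendsto (fun n => u n x) atTop (𝓝 l) := by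
  have hwm : Monotone w := fun p q hpq =>
    le_of_tendsto_of_tendsto' (hw p) (hw q) fun n => hu n (by exact_mod_cast hpq)
  let M : ℝ → ℝ := fun x => ⨆ q : {q : ℚ // (q : ℝ) ≤ x}, w q
  have hne : ∀ x : ℝ, Nonempty {q : ℚ // (q : ℝ) ≤ x} := fun x =>
    ⟨(exists_rat_lt x).choose, (exists_rat_lt x).choose_spec.le⟩
  have hbdd : ∀ x : ℝ, BddAbove (Set.range fun q : {q : ℚ // (q : ℝ) ≤ x} => w q) := by
    intro x
    obtain ⟨p, hp⟩ := exists_rat_gt x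
    refine ⟨w p, ?_⟩
    rintro _ ⟨q, rfl⟩
    exact hwm (by exact_mod_cast q.2.trans hp.le)
  have hwM : ∀ (q : ℚ) x, (q : ℝ) ≤ x → w q ≤ M x := fun q x h =>
    le_ciSup (hbdd x) ⟨q, h⟩
  have hMw : ∀ (q : ℚ) x, x ≤ (q : ℝ) → M x ≤ w q := fun q x h => by
    have := hne x
    exact ciSup_le fun p => hwm (by exact_mod_cast p.2.trans h)
  have hM : Monotone M := fun x y hxy => by
    have := hne x
    exact ciSup_le fun p => hwM p y (p.2.trans hxy)
  refine ⟨_, hM.countable_not_continuousAt, fun x hx => ⟨M x, ?_⟩⟩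
  have hx : ContinuousAt M x := not_not.1 hx
  refine tendsto_order.2 ⟨fun a ha => ?_, fun a ha => ?_⟩
  · obtain ⟨y, hy, hyx⟩ := ((hx.tendsto.eventually_const_lt ha).filter_mono
      nhdsWithin_le_nhds |>.and self_mem_nhdsWithin : ∀ᶠ y in 𝓝[<] x, a < M y ∧ y < x).exists
    obtain ⟨q, hyq, hqx⟩ := exists_rat_btwn hyx
    filter_upwards [(hw q).eventually_const_lt (hy.trans_le (hMw q y hyq.le))] with n hn
    exact hn.trans_le (hu n hqx.le)
  · obtain ⟨y, hy, hyx⟩ := ((hx.tendsto.eventually_lt_const ha).filter_mono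
      nhdsWithin_le_nhds |>.and self_mem_nhdsWithin : ∀ᶠ y in 𝓝[>] x, M y < a ∧ x < y).exists
    obtain ⟨q, hxq, hqy⟩ := exists_rat_btwn hyx
    filter_upwards [(hw q).eventually_lt_const ((hwM q y hqy.le).trans_lt hy)] with n hn
    exact (hu n hxq.le).trans_lt hn

/-- **Helly's selection theorem** for countably many sequences of monotone functions. -/
theorem IsCompact.exists_subseq_tendsto_of_monotone {J : Type*} [Countable J] {K : Set ℝ}
    (hK : IsCompact K) (u : ℕ → J → ℝ → ℝ) (hmono : ∀ n j, Monotone (u n j))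
    (hu : ∀ n j x, u n j x ∈ K) :
    ∃ φ : ℕ → ℕ, StrictMono φ ∧ ∃ v : J → ℝ → ℝ,
      ∀ j x, Tendsto (fun n => u (φ n) j x) atTop (𝓝 (v j x)) := by
  obtain ⟨φ, hφ, w, hw⟩ := hK.exists_subseq_tendsto_pi (fun n (p : J × ℚ) => u n p.1 p.2)
    fun n p => hu n _ _
  choose D hD hlim using fun j => exists_countable_forall_tendsto (fun n => hmono (φ n) j)
    fun q => hw (j, q)
  have : Countable (⋃ j, D j) := (Set.countable_iUnion hD).to_subtype
  obtain ⟨ψ, hψ, w', hw'⟩ := hK.exists_subseq_tendsto_pi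
    (fun n (p : J × ⋃ j, D j) => u (φ n) p.1 p.2) fun n p => hu _ _ _
  have hex : ∀ j x, ∃ l, Tendsto (fun n => u (φ (ψ n)) j x) atTop (𝓝 l) := by
    intro j x
    by_cases hx : x ∈ ⋃ j, D j
    · exact ⟨_, hw' (j, ⟨x, hx⟩)⟩
    · obtain ⟨l, hl⟩ := hlim j x fun h => hx (Set.mem_iUnion_of_mem j h)
      exact ⟨l, hl.comp hψ.tendsto_atTop⟩
  choose v hv using hex
  exact ⟨φ ∘ ψ, hφ.comp hψ, v, hv⟩

end Helly

section Interpolation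

variable {ι : Type*} [Finite ι]

/-- At `x`, interpolate the functions `b i` by the largest value `b i x` among the indices `i` whose
weight is not smaller, by more than the factor `sigmoid (-x)`, than the other weights. -/
noncomputable def interp (w : ι → ℝ) (b : ι → ℝ → ℝ) (x : ℝ) : ℝ :=
  sSup ((fun i => b i x) '' {i | ∀ j, Real.sigmoid (-x) * w j < w i})

lemma interp_index_nonempty {w : ι → ℝ} (hpos : ∃ i, 0 < w i) (x : ℝ) :
    {i | ∀ j, Real.sigmoid (-x) * w j < w i}.Nonempty := by
  obtain ⟨i₀, hi₀⟩ := hpos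
  have : Nonempty ι := ⟨i₀⟩
  obtain ⟨i, hi⟩ := Finite.exists_max w
  have hwi : 0 < w i := hi₀.trans_le (hi i₀)
  refine ⟨i, fun j => ?_⟩
  calc Real.sigmoid (-x) * w j ≤ Real.sigmoid (-x) * w i :=
        mul_le_mul_of_nonneg_left (hi j) (Real.sigmoid_nonneg _)
    _ < w i := mul_lt_of_lt_one_left hwi (Real.sigmoid_lt_one _)

lemma exists_interp_eq {w : ι → ℝ} (hpos : ∃ i, 0 < w i) (b : ι → ℝ → ℝ) (x : ℝ) :
    ∃ i, 0 < w i ∧ interp w b x = b i x := by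
  obtain ⟨i, hi, h⟩ := ((interp_index_nonempty hpos x).image fun i => b i x).csSup_mem
    (Set.toFinite _)
  refine ⟨i, ?_, h.symm⟩
  nlinarith [hi i, Real.sigmoid_lt_one (-x)]

lemma interp_monotone {w : ι → ℝ} (hw : ∀ i, 0 ≤ w i) (hpos : ∃ i, 0 < w i) {b : ι → ℝ → ℝ}
    (hb : ∀ i, Monotone (b i)) : Monotone (interp w b) := by
  intro x y hxy
  refine csSup_le ((interp_index_nonempty hpos x).image _) ?_
  rintro _ ⟨i, hi, rfl⟩
  refine (hb i hxy).trans (le_csSup (Set.toFinite _).bddAbove ⟨i, fun j => ?_, rfl⟩)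
  exact (mul_le_mul_of_nonneg_right (Real.sigmoid_monotone (neg_le_neg hxy)) (hw j)).trans_lt (hi j)

/-- Away from countably many points, the interpolation is locally constant in the weights. -/
lemma countable_not_eventually_interp_eq {w : ι → ℝ} (hpos : ∃ i, 0 < w i)
    (b : ι → ℝ → ℝ) :
    {x | ¬ ∀ᶠ w' in 𝓝 w, interp w' b x = interp w b x}.Countable := by
  have hcount : (⋃ p : ι × ι, {x | 0 < w p.1 ∧ Real.sigmoid (-x) * w p.2 = w p.1}).Countable := by
    refine Set.countable_iUnion fun p => Set.Subsingleton.countable ?_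
    rintro x ⟨hx0, hx⟩ y ⟨-, hy⟩
    have hp : w p.2 ≠ 0 := by
      intro h
      rw [h, mul_zero] at hx
      exact hx0.ne hx
    exact neg_injective (Real.sigmoid_injective (mul_right_cancel₀ hp (hx.trans hy.symm)))
  refine hcount.mono fun x hx => ?_
  by_contra hgood
  simp only [Set.mem_iUnion, Set.mem_ofPred_eq, not_exists, not_and, Prod.forall] at hgood
  refine hx ?_
  have hcont : ∀ j, Continuous fun w' : ι → ℝ => Real.sigmoid (-x) * w' j := fun j =>
    (continuous_apply j).const_mul _
  have key : ∀ i, ∀ᶠ w' in 𝓝 w, ((∀ j, Real.sigmoid (-x) * w' j < w' i) ↔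
      ∀ j, Real.sigmoid (-x) * w j < w i) := by
    intro i
    by_cases hi : ∀ j, Real.sigmoid (-x) * w j < w i
    · have : ∀ᶠ w' in 𝓝 w, ∀ j, Real.sigmoid (-x) * w' j < w' i := eventually_all.2 fun j =>
        (hcont j).continuousAt.eventually_lt (continuous_apply i).continuousAt (hi j)
      filter_upwards [this] with w' hw'
      exact iff_of_true hw' hi
    · have hex : ∃ j, w i < Real.sigmoid (-x) * w j := by
        by_contra! hle
        refine hi fun j => lt_of_le_of_ne (hle j) (hgood i j ?_)
        obtain ⟨k, hk⟩ := hpos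
        exact (mul_pos (Real.sigmoid_pos _) hk).trans_le (hle k)
      obtain ⟨j, hj⟩ := hex
      filter_upwards [(continuous_apply i).continuousAt.eventually_lt (hcont j).continuousAt hj]
        with w' hw'
      exact iff_of_false (fun h => (h j).not_gt hw') hi
  filter_upwards [eventually_all.2 key] with w' hw'
  simp only [interp, hw']

end Interpolation

section Partition

variable {ι : Type*} [Fintype ι]

/-- The tensor product hat function of the grid point `v / N`. -/
noncomputable def gridHat (N : ℕ) (v : ι → Fin (N + 1)) (l : ι → ℝ) : ℝ :=
  ∏ i, max 0 (1 - |N * l i - (v i : ℕ)|)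

lemma continuous_gridHat (N : ℕ) (v : ι → Fin (N + 1)) : Continuous (gridHat N v) := by
  unfold gridHat
  fun_prop

lemma gridHat_nonneg (N : ℕ) (v : ι → Fin (N + 1)) (l : ι → ℝ) : 0 ≤ gridHat N v l :=
  Finset.prod_nonneg fun _ _ => le_max_left _ _

lemma abs_lt_one_of_gridHat_pos {N : ℕ} {v : ι → Fin (N + 1)} {l : ι → ℝ} (h : 0 < gridHat N v l)
    (i : ι) : |N * l i - (v i : ℕ)| < 1 := by
  by_contra! hle
  refine h.ne' (Finset.prod_eq_zero (Finset.mem_univ i) ?_)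
  exact max_eq_left (by linarith)

lemma exists_gridHat_pos (N : ℕ) {l : ι → ℝ} (hl : l ∈ stdSimplex ℝ ι) :
    ∃ v, 0 < gridHat N v l := by
  have hnn : ∀ i, 0 ≤ N * l i := fun i => mul_nonneg N.cast_nonneg (hl.1 i)
  have hle : ∀ i, ⌊N * l i⌋₊ < N + 1 := by
    intro i
    rw [Nat.floor_lt (hnn i)]
    have h1 : l i ≤ 1 := hl.2 ▸ Finset.single_le_sum (fun j _ => hl.1 j) (Finset.mem_univ i)
    push_cast
    nlinarith [(N.cast_nonneg : (0 : ℝ) ≤ N)]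
  refine ⟨fun i => ⟨_, hle i⟩, Finset.prod_pos fun i _ => lt_max_of_lt_right ?_⟩
  have h1 := Nat.floor_le (hnn i)
  have h2 := Nat.lt_floor_add_one (N * l i)
  rw [sub_pos, abs_lt]
  constructor <;> linarith

/-- At most `2 ^ #ι` of the hat functions are active at a given point. -/
lemma exists_gridHat_active (N : ℕ) {l : ι → ℝ} (hl : l ∈ stdSimplex ℝ ι) :
    ∃ a : (ι → Bool) → ι → Fin (N + 1), (∀ k, 0 < gridHat N (a k) l) ∧
      ∀ v, 0 < gridHat N v l → ∃ k, a k = v := by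
  classical
  have hne : Nonempty {v : ι → Fin (N + 1) // 0 < gridHat N v l} :=
    nonempty_subtype.2 (exists_gridHat_pos N hl)
  let f : {v : ι → Fin (N + 1) // 0 < gridHat N v l} → ι → Bool :=
    fun v i => decide (N * l i < (v.1 i : ℕ))
  have hf : Function.Injective f := by
    rintro ⟨v, hv⟩ ⟨w, hw⟩ hvw
    ext i
    have h1 := abs_lt.1 (abs_lt_one_of_gridHat_pos hv i)
    have h2 := abs_lt.1 (abs_lt_one_of_gridHat_pos hw i)
    have h3 : (N * l i < (v i : ℕ)) ↔ (N * l i < (w i : ℕ)) := by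
      simpa [f] using congrFun hvw i
    have h4 : ((v i : ℕ) : ℝ) < (w i : ℕ) + 1 ∧ ((w i : ℕ) : ℝ) < (v i : ℕ) + 1 := by
      by_cases h : N * l i < (v i : ℕ)
      · have := h3.1 h
        constructor <;> linarith
      · have := mt h3.2 h
        constructor <;> linarith
    have h5 : (v i : ℕ) < (w i : ℕ) + 1 ∧ (w i : ℕ) < (v i : ℕ) + 1 := by exact_mod_cast h4
    simp only
    omega
  refine ⟨fun k => (Function.invFun f k).1, fun k => (Function.invFun f k).2, fun v hv => ?_⟩
  obtain ⟨k, hk⟩ := Function.invFun_surjective hf ⟨v, hv⟩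
  exact ⟨k, congrArg Subtype.val hk⟩

end Partition

section Selection

/-- A relation on a family of monotone functions which is closed under pointwise limits, under
switching between finitely many functions, and under modifications on null subsets of the unit
interval. -/
structure IsMonotoneSelection (K : Set ℝ) (M : Set (ℝ → ℝ)) (R : (ℝ → ℝ) → (ℝ → ℝ) → Prop) :
    Prop where
  compact : IsCompact K
  nonempty : M.Nonempty
  mono : ∀ m ∈ M, Monotone m
  mem : ∀ m ∈ M, ∀ x, m x ∈ K
  closed : ∀ (u : ℕ → ℝ → ℝ) m, (∀ n, u n ∈ M) →
    (∀ x, Tendsto (fun n => u n x) atTop (𝓝 (m x))) → m ∈ M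
  switch : ∀ D : Set (ℝ → ℝ), D.Finite → D ⊆ M → ∀ h, Monotone h →
    (∀ x, ∃ b ∈ D, h x = b x) → h ∈ M
  rel_mem : ∀ m ∈ M, ∀ b, R m b → b ∈ M
  exists_rel : ∀ m ∈ M, ∃ b, R m b
  rel_switch : ∀ m ∈ M, ∀ D : Set (ℝ → ℝ), D.Finite → (∀ b ∈ D, R m b) → ∀ h, Monotone h →
    (∀ x, ∃ b ∈ D, h x = b x) → R m h
  rel_closed : ∀ (u v : ℕ → ℝ → ℝ) m b, (∀ n, u n ∈ M) → (∀ n, R (u n) (v n)) →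
    (∀ x, Tendsto (fun n => u n x) atTop (𝓝 (m x))) →
    (∀ x, Tendsto (fun n => v n x) atTop (𝓝 (b x))) → R m b
  rel_congr : ∀ m ∈ M, ∀ m' ∈ M, ∀ b, ∀ b' ∈ M, R m b →
    m =ᵐ[volume.restrict (Set.Icc 0 1)] m' → b =ᵐ[volume.restrict (Set.Icc 0 1)] b' → R m' b'

variable {K : Set ℝ} {M : Set (ℝ → ℝ)} {R : (ℝ → ℝ) → (ℝ → ℝ) → Prop}

lemma IsMonotoneSelection.rel_of_ae_tendsto (hM : IsMonotoneSelection K M R) {u v : ℕ → ℝ → ℝ}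
    {m b : ℝ → ℝ} (hu : ∀ n, u n ∈ M) (huv : ∀ n, R (u n) (v n)) (hm : m ∈ M) (hb : b ∈ M)
    (hum : ∀ᵐ x ∂volume.restrict (Set.Icc 0 1), Tendsto (fun n => u n x) atTop (𝓝 (m x)))
    (hvb : ∀ᵐ x ∂volume.restrict (Set.Icc 0 1), Tendsto (fun n => v n x) atTop (𝓝 (b x))) :
    R m b := by
  have hv : ∀ n, v n ∈ M := fun n => hM.rel_mem _ (hu n) _ (huv n)
  obtain ⟨φ, hφ, w, hw⟩ := hM.compact.exists_subseq_tendsto_of_monotone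
    (fun n (k : Bool) => cond k (u n) (v n))
    (by rintro n (_ | _); exacts [hM.mono _ (hv n), hM.mono _ (hu n)])
    (by rintro n (_ | _); exacts [hM.mem _ (hv n), hM.mem _ (hu n)])
  have hwt : w true ∈ M := hM.closed _ _ (fun n => hu (φ n)) (hw true)
  have hwf : w false ∈ M := hM.closed _ _ (fun n => hv (φ n)) (hw false)
  refine hM.rel_congr _ hwt _ hm _ _ hb
    (hM.rel_closed _ _ _ _ (fun n => hu (φ n)) (fun n => huv (φ n)) (hw true) (hw false)) ?_ ?_
  · filter_upwards [hum] with x hx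
    exact tendsto_nhds_unique (hw true x) (hx.comp hφ.tendsto_atTop)
  · filter_upwards [hvb] with x hx
    exact tendsto_nhds_unique (hw false x) (hx.comp hφ.tendsto_atTop)

lemma IsMonotoneSelection.interp_mem (hM : IsMonotoneSelection K M R) {ι : Type*} [Finite ι]
    {w : ι → ℝ} (hw : ∀ i, 0 ≤ w i) (hpos : ∃ i, 0 < w i) {b : ι → ℝ → ℝ} (hb : ∀ i, b i ∈ M) :
    interp w b ∈ M := by
  refine hM.switch (Set.range b) (Set.finite_range b) (Set.range_subset_iff.2 hb) _
    (interp_monotone hw hpos fun i => hM.mono _ (hb i)) fun x => ?_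
  obtain ⟨i, -, hi⟩ := exists_interp_eq hpos b x
  exact ⟨b i, ⟨i, rfl⟩, hi⟩

lemma ae_eventually_interp_eq {ι : Type*} [Finite ι] {w : ι → ℝ} (hpos : ∃ i, 0 < w i)
    (b : ι → ℝ → ℝ) : ∀ᵐ x ∂volume.restrict (Set.Icc (0 : ℝ) 1),
      ∀ᶠ w' in 𝓝 w, interp w' b x = interp w b x := by
  filter_upwards [(countable_not_eventually_interp_eq hpos b).ae_notMem _] with x hx
  exact not_not.1 hx

lemma exists_pos_of_mem_stdSimplex {ι : Type*} [Fintype ι] {l : ι → ℝ} (hl : l ∈ stdSimplex ℝ ι) :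
    ∃ i, 0 < l i := by
  by_contra! h
  have := Finset.sum_nonpos fun i (_ : i ∈ Finset.univ) => h i
  rw [hl.2] at this
  exact not_lt.2 this one_pos

end Selection

section Inner

variable {K : Set ℝ} {M : Set (ℝ → ℝ)} {R : (ℝ → ℝ) → (ℝ → ℝ) → Prop}

/-- Brouwer's theorem applied to an interpolation of the functions `b` over a grid. -/
lemma IsMonotoneSelection.exists_grid_fixed_point (hM : IsMonotoneSelection K M R) {ι : Type*}
    [Fintype ι] [Nonempty ι] {r : (ℝ → ℝ) → ι → ℝ} (hr : ∀ g ∈ M, r g ∈ stdSimplex ℝ ι)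
    (hrc : ∀ (u : ℕ → ℝ → ℝ) g, (∀ n, u n ∈ M) → g ∈ M →
      (∀ᵐ x ∂volume.restrict (Set.Icc 0 1), Tendsto (fun n => u n x) atTop (𝓝 (g x))) →
      Tendsto (fun n => r (u n)) atTop (𝓝 (r g)))
    {b : (ι → ℝ) → ℝ → ℝ} (hb : ∀ l ∈ stdSimplex ℝ ι, b l ∈ M) (N : ℕ) :
    ∃ l ∈ stdSimplex ℝ ι, ∃ c : (ι → Bool) → ι → ℝ,
      (∀ k, c k ∈ stdSimplex ℝ ι ∧ ∀ i, |c k i - l i| ≤ 2 / (N + 1 : ℝ)) ∧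
      ∃ g ∈ M, r g = l ∧ ∀ x, ∃ k, g x = b (c k) x := by
  classical
  have hex : ∀ v : ι → Fin (N + 1 + 1), ∃ c ∈ stdSimplex ℝ ι,
      (∃ l ∈ stdSimplex ℝ ι, 0 < gridHat (N + 1) v l) → 0 < gridHat (N + 1) v c := by
    intro v
    by_cases h : ∃ l ∈ stdSimplex ℝ ι, 0 < gridHat (N + 1) v l
    · obtain ⟨l, hl, hv⟩ := h
      exact ⟨l, hl, fun _ => hv⟩
    · exact ⟨_, single_mem_stdSimplex ℝ (Classical.arbitrary ι), fun h' => absurd h' h⟩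
  choose c hc hcv using hex
  let G : (ι → ℝ) → ℝ → ℝ := fun l => interp (fun v => gridHat (N + 1) v l) fun v => b (c v)
  have hG : ∀ l ∈ stdSimplex ℝ ι, G l ∈ M := fun l hl =>
    hM.interp_mem (fun v => gridHat_nonneg _ v l) (exists_gridHat_pos _ hl) fun v => hb _ (hc v)
  have hcont : ContinuousOn (fun l => r (G l)) (stdSimplex ℝ ι) := by
    intro l hl
    refine tendsto_of_seq_tendsto fun u hu => ?_
    obtain ⟨hu1, hu2⟩ := tendsto_nhdsWithin_iff.1 hu
    obtain ⟨n₀, hn₀⟩ := eventually_atTop.1 hu2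
    rw [← tendsto_add_atTop_iff_nat n₀]
    refine hrc _ _ (fun n => hG _ (hn₀ _ (Nat.le_add_left _ _))) (hG l hl) ?_
    filter_upwards [ae_eventually_interp_eq (exists_gridHat_pos (N + 1) hl) fun v => b (c v)]
      with x hx
    have hw : Tendsto (fun n v => gridHat (N + 1) v (u (n + n₀))) atTop
        (𝓝 fun v => gridHat (N + 1) v l) :=
      tendsto_pi_nhds.2 fun v => ((continuous_gridHat _ v).tendsto l).comp
        (hu1.comp (tendsto_add_atTop_nat n₀))
    exact tendsto_const_nhds.congr' ((hw.eventually hx).mono fun n hn => hn.symm)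
  obtain ⟨l, hl, hfix⟩ := exists_fixed_point_stdSimplex hcont fun l hl => hr _ (hG l hl)
  obtain ⟨a, ha, ha'⟩ := exists_gridHat_active (N + 1) hl
  refine ⟨l, hl, fun k => c (a k), fun k => ⟨hc _, fun i => ?_⟩, G l, hG l hl, hfix, fun x => ?_⟩
  · have h1 := abs_lt.1 (abs_lt_one_of_gridHat_pos (ha k) i)
    have h2 := abs_lt.1 (abs_lt_one_of_gridHat_pos (hcv _ ⟨l, hl, ha k⟩) i)
    have hN : (0 : ℝ) < N + 1 := by positivity
    push_cast at h1 h2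
    rw [abs_le, ← neg_div, div_le_iff₀ hN, le_div_iff₀ hN]
    constructor <;> linarith
  · obtain ⟨v, hv, hvx⟩ := exists_interp_eq (exists_gridHat_pos (N + 1) hl) (fun v => b (c v)) x
    obtain ⟨k, rfl⟩ := ha' v hv
    exact ⟨k, hvx⟩

/-- The finite-dimensional fixed point problem given by a retraction `r` onto a simplex. -/
lemma IsMonotoneSelection.exists_rel_interp (hM : IsMonotoneSelection K M R) {ι : Type*}
    [Fintype ι] [Nonempty ι] {m : ι → ℝ → ℝ} (hm : ∀ i, m i ∈ M)
    {r : (ℝ → ℝ) → ι → ℝ} (hr : ∀ g ∈ M, r g ∈ stdSimplex ℝ ι)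
    (hrc : ∀ (u : ℕ → ℝ → ℝ) g, (∀ n, u n ∈ M) → g ∈ M →
      (∀ᵐ x ∂volume.restrict (Set.Icc 0 1), Tendsto (fun n => u n x) atTop (𝓝 (g x))) →
      Tendsto (fun n => r (u n)) atTop (𝓝 (r g))) :
    ∃ g ∈ M, R (interp (r g) m) g := by
  classical
  have hint : ∀ l ∈ stdSimplex ℝ ι, interp l m ∈ M := fun l hl =>
    hM.interp_mem hl.1 (exists_pos_of_mem_stdSimplex hl) hm
  have hex : ∀ l : ι → ℝ, ∃ b, l ∈ stdSimplex ℝ ι → R (interp l m) b := by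
    intro l
    by_cases hl : l ∈ stdSimplex ℝ ι
    · obtain ⟨b, hb⟩ := hM.exists_rel _ (hint l hl)
      exact ⟨b, fun _ => hb⟩
    · exact ⟨0, fun h => absurd h hl⟩
  choose b hbR using hex
  have hb : ∀ l ∈ stdSimplex ℝ ι, b l ∈ M := fun l hl => hM.rel_mem _ (hint l hl) _ (hbR l hl)
  choose l hl c hc g hgM hgr hg using fun N : ℕ => hM.exists_grid_fixed_point hr hrc hb N
  obtain ⟨l₀, hl₀, φ, hφ, hlim⟩ := (isCompact_stdSimplex ℝ ι).tendsto_subseq hl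
  obtain ⟨ψ, hψ, v, hv⟩ := hM.compact.exists_subseq_tendsto_of_monotone
    (fun n (k : Option (ι → Bool)) => k.elim (g (φ n)) fun k => b (c (φ n) k))
    (by rintro n (_ | k); exacts [hM.mono _ (hgM _), hM.mono _ (hb _ (hc _ k).1)])
    (by rintro n (_ | k); exacts [hM.mem _ (hgM _), hM.mem _ (hb _ (hc _ k).1)])
  have hvM : ∀ k, v k ∈ M := by
    rintro (_ | k)
    · exact hM.closed _ _ (fun n => hgM (φ (ψ n))) (hv none)
    · exact hM.closed _ _ (fun n => hb _ (hc (φ (ψ n)) k).1) (hv (some k))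
  have hR : ∀ k, R (interp l₀ m) (v (some k)) := by
    intro k
    refine hM.rel_of_ae_tendsto (u := fun n => interp (c (φ (ψ n)) k) m)
      (v := fun n => b (c (φ (ψ n)) k))
      (fun n => hint _ (hc _ k).1) (fun n => hbR _ (hc _ k).1) (hint _ hl₀) (hvM _) ?_
      (Eventually.of_forall (hv (some k)))
    have hclim : Tendsto (fun n => c (φ (ψ n)) k) atTop (𝓝 l₀) := by
      rw [tendsto_pi_nhds] at hlim ⊢
      intro i
      have h0 : Tendsto (fun n => c (φ (ψ n)) k i - l (φ (ψ n)) i) atTop (𝓝 0) := by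
        refine squeeze_zero_norm (fun n => (hc (φ (ψ n)) k).2 i) ?_
        exact ((tendsto_const_div_atTop_nhds_zero_nat (2 : ℝ)).comp
          (tendsto_add_atTop_nat 1) |>.comp (hφ.comp hψ).tendsto_atTop).congr fun n => by simp
      simpa using h0.add ((hlim i).comp hψ.tendsto_atTop)
    filter_upwards [ae_eventually_interp_eq (exists_pos_of_mem_stdSimplex hl₀) m] with x hx
    exact tendsto_const_nhds.congr' ((hclim.eventually hx).mono fun n hn => hn.symm)
  have hrg : r (v none) = l₀ := by
    refine tendsto_nhds_unique (hrc _ _ (fun n => hgM (φ (ψ n))) (hvM none)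
      (Eventually.of_forall (hv none))) ?_
    simp only [hgr]
    exact hlim.comp hψ.tendsto_atTop
  refine ⟨v none, hvM none, hrg.symm ▸ hM.rel_switch _ (hint _ hl₀)
    (Set.range fun k => v (some k)) (Set.finite_range _) (Set.forall_mem_range.2 hR) _
    (hM.mono _ (hvM none)) fun x => ?_⟩
  by_contra! hne
  have hev : ∀ᶠ n in atTop, ∀ k, g (φ (ψ n)) x ≠ b (c (φ (ψ n)) k) x := eventually_all.2 fun k =>
    (((hv none x).sub (hv (some k) x)).eventually_ne (sub_ne_zero.2 (hne _ ⟨k, rfl⟩))).mono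
      fun n hn => sub_ne_zero.1 hn
  obtain ⟨n, hn⟩ := hev.exists
  obtain ⟨k, hk⟩ := hg (φ (ψ n)) x
  exact hn k hk

end Inner

section Outer

variable {K : Set ℝ} {M : Set (ℝ → ℝ)} {R : (ℝ → ℝ) → (ℝ → ℝ) → Prop}

/-- Fixed points up to a small error in finitely many functionals. -/
lemma IsMonotoneSelection.exists_approx (hM : IsMonotoneSelection K M R) {d : ℕ}
    {A : (ℝ → ℝ) → Fin d → ℝ} (hbdd : Bornology.IsBounded (A '' M))
    (hA : ∀ (u : ℕ → ℝ → ℝ) g, (∀ n, u n ∈ M) → g ∈ M →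
      (∀ᵐ x ∂volume.restrict (Set.Icc 0 1), Tendsto (fun n => u n x) atTop (𝓝 (g x))) →
      Tendsto (fun n => A (u n)) atTop (𝓝 (A g)))
    {ε : ℝ} (hε : 0 < ε) :
    ∃ f ∈ M, ∃ g ∈ M, R f g ∧ ∀ x, ∃ m ∈ M, f x = m x ∧ ∀ j, |A g j - A m j| < ε := by
  obtain ⟨t, htM, htfin, hcover⟩ :=
    Metric.finite_approx_of_totallyBounded
      (hbdd.isCompact_closure.totallyBounded.subset subset_closure) ε hε
  have : Fintype t := htfin.fintype
  choose m hmM hmt using fun i : t => htM i.2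
  have : Nonempty t := by
    obtain ⟨g, hg⟩ := hM.nonempty
    obtain ⟨i, hi, -⟩ := Set.mem_iUnion₂.1 (hcover (Set.mem_image_of_mem A hg))
    exact ⟨⟨i, hi⟩⟩
  let p : t → (ℝ → ℝ) → ℝ := fun i g => max 0 (ε - dist (A g) i)
  have hp : ∀ i g, 0 ≤ p i g := fun i g => le_max_left _ _
  have hsum : ∀ g ∈ M, 0 < ∑ i, p i g := by
    intro g hg
    obtain ⟨i, hi, hgi⟩ := Set.mem_iUnion₂.1 (hcover (Set.mem_image_of_mem A hg))
    exact Finset.sum_pos' (fun i _ => hp i g)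
      ⟨⟨i, hi⟩, Finset.mem_univ _, lt_max_of_lt_right (sub_pos.2 hgi)⟩
  let r : (ℝ → ℝ) → t → ℝ := fun g i => p i g / ∑ i, p i g
  have hr : ∀ g ∈ M, r g ∈ stdSimplex ℝ t := by
    intro g hg
    refine ⟨fun i => div_nonneg (hp i g) (hsum g hg).le, ?_⟩
    simp only [r]
    rw [← Finset.sum_div, div_self (hsum g hg).ne']
  obtain ⟨g, hg, hR⟩ := hM.exists_rel_interp hmM hr fun u g hu hg hug => by
    have hp_lim : ∀ i, Tendsto (fun n => p i (u n)) atTop (𝓝 (p i g)) := fun i =>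
      tendsto_const_nhds.max (tendsto_const_nhds.sub ((hA u g hu hg hug).dist tendsto_const_nhds))
    exact tendsto_pi_nhds.2 fun i => (hp_lim i).div
      (tendsto_finsetSum _ fun i _ => hp_lim i) (hsum g hg).ne'
  have hpos := exists_pos_of_mem_stdSimplex (hr g hg)
  refine ⟨_, hM.interp_mem (hr g hg).1 hpos hmM, g, hg, hR, fun x => ?_⟩
  obtain ⟨i, hi, hix⟩ := exists_interp_eq hpos m x
  refine ⟨m i, hmM i, hix, fun j => ?_⟩
  have h1 : 0 < p i g := by
    by_contra! hle
    exact not_lt.2 (div_nonpos_of_nonpos_of_nonneg hle (hsum g hg).le) hi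
  have h2 : dist (A g) (A (m i)) < ε := by
    rw [hmt i]
    exact sub_pos.1 ((lt_max_iff.1 h1).resolve_left (lt_irrefl _))
  exact (Real.dist_eq _ _ ▸ dist_le_pi_dist (A g) (A (m i)) j).trans_lt h2

lemma IsMonotoneSelection.tendsto_intervalIntegral (hM : IsMonotoneSelection K M R)
    {u : ℕ → ℝ → ℝ} {g : ℝ → ℝ} (hu : ∀ n, u n ∈ M)
    (hug : ∀ᵐ x ∂volume.restrict (Set.Icc 0 1), Tendsto (fun n => u n x) atTop (𝓝 (g x)))
    {a b : ℝ} (ha : 0 ≤ a) (hab : a ≤ b) (hb : b ≤ 1) :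
    Tendsto (fun n => ∫ x in a..b, u n x) atTop (𝓝 (∫ x in a..b, g x)) := by
  obtain ⟨C, hC⟩ := hM.compact.isBounded.exists_norm_le
  refine intervalIntegral.tendsto_integral_filter_of_dominated_convergence (fun _ => C)
    (Eventually.of_forall fun n => (hM.mono _ (hu n)).measurable.aestronglyMeasurable)
    (Eventually.of_forall fun n => Eventually.of_forall fun x _ => hC _ (hM.mem _ (hu n) x))
    intervalIntegrable_const ?_
  filter_upwards [(ae_restrict_iff' measurableSet_Icc).1 hug] with x hx hxab
  rw [Set.uIoc_of_le hab] at hxab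
  exact hx ⟨ha.trans hxab.1.le, hxab.2.trans hb⟩

lemma Monotone.mul_le_intervalIntegral {m : ℝ → ℝ} (hm : Monotone m) {a b : ℝ} (hab : a ≤ b) :
    (b - a) * m a ≤ ∫ x in a..b, m x := by
  have := intervalIntegral.integral_mono_on (μ := volume) hab (intervalIntegrable_const (c := m a))
    hm.intervalIntegrable fun x hx => hm hx.1
  simpa using this

lemma Monotone.intervalIntegral_le_mul {m : ℝ → ℝ} (hm : Monotone m) {a b : ℝ} (hab : a ≤ b) :
    ∫ x in a..b, m x ≤ (b - a) * m b := by
  have := intervalIntegral.integral_mono_on (μ := volume) hab hm.intervalIntegrable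
    (intervalIntegrable_const (c := m b)) fun x hx => hm hx.2
  simpa using this

/-- The rational subintervals of the unit interval. -/
abbrev RatInterval : Type := {p : ℚ × ℚ // 0 ≤ p.1 ∧ p.1 ≤ p.2 ∧ p.2 ≤ 1}

/-- A monotone selection relation has a fixed point. -/
theorem IsMonotoneSelection.exists_fixed_point (hM : IsMonotoneSelection K M R) :
    ∃ b ∈ M, R b b := by
  have : Nonempty RatInterval := ⟨⟨(0, 0), by norm_num⟩⟩
  obtain ⟨e, he⟩ := exists_surjective_nat RatInterval
  let A : ℕ → (ℝ → ℝ) → ℝ := fun j g => ∫ x in (((e j).1.1 : ℚ) : ℝ)..(((e j).1.2 : ℚ) : ℝ), g x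
  have he0 : ∀ j, (0 : ℝ) ≤ ((e j).1.1 : ℚ) := fun j => by exact_mod_cast (e j).2.1
  have hele : ∀ j, (((e j).1.1 : ℚ) : ℝ) ≤ ((e j).1.2 : ℚ) := fun j => by exact_mod_cast (e j).2.2.1
  have he1 : ∀ j, (((e j).1.2 : ℚ) : ℝ) ≤ 1 := fun j => by exact_mod_cast (e j).2.2.2
  obtain ⟨C, hC⟩ := hM.compact.isBounded.exists_norm_le
  have hbdd : ∀ d : ℕ, Bornology.IsBounded ((fun g (j : Fin d) => A j g) '' M) := by
    intro d
    refine (Bornology.IsBounded.pi fun _ : Fin d =>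
      (Metric.isBounded_closedBall : Bornology.IsBounded (Metric.closedBall (0 : ℝ) C))).subset ?_
    rintro _ ⟨g, hg, rfl⟩ j -
    rw [mem_closedBall_zero_iff]
    refine (intervalIntegral.norm_integral_le_of_norm_le_const fun x _ =>
      hC _ (hM.mem g hg x)).trans ?_
    have hC0 : 0 ≤ C := (norm_nonneg _).trans (hC _ (hM.mem g hg 0))
    rw [abs_of_nonneg (sub_nonneg.2 (hele j))]
    exact mul_le_of_le_one_right hC0 (by linarith [he0 j, he1 j])
  choose f hf g hg hR happ using fun d : ℕ => hM.exists_approx (hbdd d)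
    (fun u g hu _ hug => tendsto_pi_nhds.2 fun j =>
      hM.tendsto_intervalIntegral hu hug (he0 j) (hele j) (he1 j))
    (Nat.one_div_pos_of_nat (α := ℝ) (n := d))
  obtain ⟨φ, hφ, v, hv⟩ := hM.compact.exists_subseq_tendsto_of_monotone
    (fun n (_ : Unit) => g n) (fun n _ => hM.mono _ (hg n)) (fun n _ => hM.mem _ (hg n))
  replace hv := hv ()
  have hb : v () ∈ M := hM.closed _ _ (fun n => hg (φ n)) hv
  set b := v ()
  have hbm := hM.mono _ hb
  have hsmall : ∀ c : ℝ, Tendsto (fun n => (1 / ((φ n : ℝ) + 1)) / c) atTop (𝓝 0) := fun c => by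
    simpa using (tendsto_one_div_add_atTop_nhds_zero_nat (𝕜 := ℝ).comp hφ.tendsto_atTop).div_const c
  have hclose : ∀ q q' : ℚ, 0 ≤ q → q ≤ q' → q' ≤ 1 → ∀ᶠ n in atTop, ∀ x, ∃ m ∈ M,
      f (φ n) x = m x ∧ |(∫ y in (q : ℝ)..q', g (φ n) y) - ∫ y in (q : ℝ)..q', m y|
        < 1 / ((φ n : ℝ) + 1) := by
    intro q q' h0 h1 h2
    obtain ⟨j, hj⟩ := he ⟨(q, q'), h0, h1, h2⟩
    filter_upwards [hφ.tendsto_atTop.eventually_gt_atTop j] with n hn x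
    obtain ⟨m, hmM, hfm, hm⟩ := happ (φ n) x
    refine ⟨m, hmM, hfm, ?_⟩
    have := hm ⟨j, hn⟩
    simpa only [A, hj] using this
  refine ⟨b, hb, hM.rel_of_ae_tendsto (fun n => hf (φ n)) (fun n => hR (φ n)) hb hb ?_
    (Eventually.of_forall hv)⟩
  have h01 : ∀ᵐ x ∂volume.restrict (Set.Icc (0 : ℝ) 1), x ∈ Set.Ioo (0 : ℝ) 1 := by
    rw [← restrict_Ioo_eq_restrict_Icc]
    exact ae_restrict_mem measurableSet_Ioo
  filter_upwards [h01, hbm.countable_not_continuousAt.ae_notMem _] with x hx01 hx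
  have hx : ContinuousAt b x := not_not.1 hx
  refine tendsto_order.2 ⟨fun a ha => ?_, fun a ha => ?_⟩
  · obtain ⟨y, hy, hyx⟩ := ((hx.tendsto.eventually_const_lt ha).filter_mono
      nhdsWithin_le_nhds |>.and (Ioo_mem_nhdsLT hx01.1) :
        ∀ᶠ y in 𝓝[<] x, a < b y ∧ y ∈ Set.Ioo 0 x).exists
    obtain ⟨q, hyq, hqx⟩ := exists_rat_btwn hyx.2
    obtain ⟨q', hqq', hqx'⟩ := exists_rat_btwn hqx
    have hpos : (0 : ℝ) < q' - q := sub_pos.2 hqq'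
    have hlim : Tendsto (fun n => g (φ n) y - (1 / ((φ n : ℝ) + 1)) / (q' - q : ℝ)) atTop
        (𝓝 (b y)) := by simpa using (hv y).sub (hsmall (q' - q))
    filter_upwards [hclose q q' (by exact_mod_cast (hyx.1.trans hyq).le) (by exact_mod_cast hqq'.le)
      (by exact_mod_cast (hqx'.trans hx01.2).le), hlim.eventually_const_lt hy] with n hn hay
    obtain ⟨m, hmM, hfm, hm⟩ := hn x
    rw [hfm]
    have h1 := (hM.mono _ (hg (φ n))).mul_le_intervalIntegral hqq'.le
    have h2 := (hM.mono _ hmM).intervalIntegral_le_mul hqq'.le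
    have h3 : (q' - q : ℝ) * g (φ n) y ≤ (q' - q) * g (φ n) q :=
      mul_le_mul_of_nonneg_left (hM.mono _ (hg (φ n)) hyq.le) hpos.le
    have h4 : (q' - q : ℝ) * m q' ≤ (q' - q) * m x :=
      mul_le_mul_of_nonneg_left (hM.mono _ hmM hqx'.le) hpos.le
    have h5 : (1 / ((φ n : ℝ) + 1)) = (q' - q : ℝ) * ((1 / ((φ n : ℝ) + 1)) / (q' - q : ℝ)) := by
      rw [mul_div_cancel₀ _ hpos.ne']
    refine lt_of_mul_lt_mul_left (a := (q' - q : ℝ)) ?_ hpos.le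
    have h6 := mul_lt_mul_of_pos_left hay hpos
    rw [mul_sub, ← h5] at h6
    linarith [(abs_lt.1 hm).2]
  · obtain ⟨y, hy, hyx⟩ := ((hx.tendsto.eventually_lt_const ha).filter_mono
      nhdsWithin_le_nhds |>.and (Ioo_mem_nhdsGT hx01.2) :
        ∀ᶠ y in 𝓝[>] x, b y < a ∧ y ∈ Set.Ioo x 1).exists
    obtain ⟨q, hxq, hqy⟩ := exists_rat_btwn hyx.1
    obtain ⟨q', hqq', hqy'⟩ := exists_rat_btwn hqy
    have hpos : (0 : ℝ) < q' - q := sub_pos.2 hqq'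
    have hlim : Tendsto (fun n => g (φ n) y + (1 / ((φ n : ℝ) + 1)) / (q' - q : ℝ)) atTop
        (𝓝 (b y)) := by simpa using (hv y).add (hsmall (q' - q))
    filter_upwards [hclose q q' (by exact_mod_cast (hx01.1.trans hxq).le)
      (by exact_mod_cast hqq'.le) (by exact_mod_cast (hqy'.trans hyx.2).le),
      hlim.eventually_lt_const hy] with n hn hay
    obtain ⟨m, hmM, hfm, hm⟩ := hn x
    rw [hfm]
    have h1 := (hM.mono _ (hg (φ n))).intervalIntegral_le_mul hqq'.le
    have h2 := (hM.mono _ hmM).mul_le_intervalIntegral hqq'.le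
    have h3 : (q' - q : ℝ) * g (φ n) q' ≤ (q' - q) * g (φ n) y :=
      mul_le_mul_of_nonneg_left (hM.mono _ (hg (φ n)) hqy'.le) hpos.le
    have h4 : (q' - q : ℝ) * m x ≤ (q' - q) * m q :=
      mul_le_mul_of_nonneg_left (hM.mono _ hmM hxq.le) hpos.le
    have h5 : (1 / ((φ n : ℝ) + 1)) = (q' - q : ℝ) * ((1 / ((φ n : ℝ) + 1)) / (q' - q : ℝ)) := by
      rw [mul_div_cancel₀ _ hpos.ne']
    refine lt_of_mul_lt_mul_left (a := (q' - q : ℝ)) ?_ hpos.le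
    have h6 := mul_lt_mul_of_pos_left hay hpos
    rw [mul_add, ← h5] at h6
    linarith [(abs_lt.1 hm).1]

end Outer

section Selection

lemma pw_of_mem {α β : Type*} {E : Set α} {g f : α → β} {s : α} (hs : s ∈ E) :
    pw E g f s = g s := by
  classical
  simp [pw, hs]

lemma pw_of_notMem {α β : Type*} {E : Set α} {g f : α → β} {s : α} (hs : s ∉ E) :
    pw E g f s = f s := by
  classical
  simp [pw, hs]

/-- A decomposable set is stable under switching between finitely many of its members. -/
lemma Decomposable.mem_of_switch {S T ι : Type*} [MeasurableSpace S] [Nonempty S]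
    {F : Set (S → T)} (hF : Decomposable F) {D : Set ι} (hD : D.Finite) {u : ι → S → T}
    (hu : ∀ i ∈ D, u i ∈ F) {E : ι → Set S} (hE : ∀ i ∈ D, MeasurableSet (E i)) {h : S → T}
    (hh : ∀ i ∈ D, ∀ s ∈ E i, h s = u i s) (hcover : ∀ s, ∃ i ∈ D, s ∈ E i) : h ∈ F := by
  obtain ⟨i₀, hi₀, -⟩ := hcover (Classical.arbitrary S)
  obtain ⟨f, hf, hfh⟩ : ∃ f ∈ F, ∀ i ∈ D, ∀ s ∈ E i, f s = h s := by
    refine Set.Finite.induction_on_subset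
      (motive := fun D' _ => ∃ f ∈ F, ∀ i ∈ D', ∀ s ∈ E i, f s = h s) D hD
      ⟨u i₀, hu i₀ hi₀, by simp⟩ ?_
    rintro i D' hi - - ⟨f, hf, hfh⟩
    refine ⟨pw (E i) (u i) f, hF f hf _ (hu i hi) _ (hE i hi), fun j hj s hs => ?_⟩
    by_cases hsi : s ∈ E i
    · rw [pw_of_mem hsi, hh i hi s hsi]
    · rw [pw_of_notMem hsi]
      rcases hj with rfl | hj
      · exact absurd hs hsi
      · exact hfh j hj s hs
  have : f = h := funext fun s => by
    obtain ⟨i, hi, hs⟩ := hcover s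
    exact hfh i hi s hs
  exact this ▸ hf

variable {S T : Type*}

/-- The function obtained by following the family `φ` along the parameter `m ∘ P`. -/
def followPath (φ : ℝ → S → T) (P : S → ℝ) (m : ℝ → ℝ) : S → T := fun s => φ (m (P s)) s

lemma tendsto_followPath [TopologicalSpace T] {φ : ℝ → S → T} {K : Set ℝ} (hK : IsClosed K)
    (hφ : ContinuousOn φ K) (P : S → ℝ) {u : ℕ → ℝ → ℝ} {m : ℝ → ℝ} (hu : ∀ n x, u n x ∈ K)
    (hum : ∀ x, Tendsto (fun n => u n x) atTop (𝓝 (m x))) :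
    Tendsto (fun n => followPath φ P (u n)) atTop (𝓝 (followPath φ P m)) := by
  refine tendsto_pi_nhds.2 fun s => ?_
  have hm : m (P s) ∈ K :=
    hK.mem_of_tendsto (hum (P s)) (Eventually.of_forall fun n => hu n (P s))
  exact tendsto_pi_nhds.1 ((hφ _ hm).tendsto.comp
    (tendsto_nhdsWithin_iff.2 ⟨hum (P s), Eventually.of_forall fun n => hu n (P s)⟩)) s

lemma monotone_of_tendsto_pointwise {u : ℕ → ℝ → ℝ} {m : ℝ → ℝ} (hu : ∀ n, Monotone (u n))
    (hum : ∀ x, Tendsto (fun n => u n x) atTop (𝓝 (m x))) : Monotone m := fun x y hxy =>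
  le_of_tendsto_of_tendsto' (hum x) (hum y) fun n => hu n hxy

variable [MeasurableSpace S] {μ : Measure S} {φ : ℝ → S → T} {P : S → ℝ}

lemma Decomposable.followPath_mem [Nonempty S] {F : Set (S → T)} (hF : Decomposable F)
    (hP : Measurable P) {D : Set (ℝ → ℝ)} (hD : D.Finite) (hmono : ∀ b ∈ D, Monotone b)
    (hu : ∀ b ∈ D, followPath φ P b ∈ F) {h : ℝ → ℝ} (hh : Monotone h)
    (hcover : ∀ x, ∃ b ∈ D, h x = b x) : followPath φ P h ∈ F := by
  refine hF.mem_of_switch hD hu (E := fun b => P ⁻¹' {x | h x = b x})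
    (fun b hb => hP (measurableSet_eq_fun hh.measurable (hmono b hb).measurable))
    (fun b _ s hs => ?_) fun s => hcover (P s)
  exact congrArg (fun x => φ x s) hs

lemma exists_null_pw_followPath (hP : Measurable P)
    (hPμ : μ.map P = volume.restrict (Set.Icc 0 1)) {m m' : ℝ → ℝ}
    (h : m =ᵐ[volume.restrict (Set.Icc 0 1)] m') :
    ∃ E, MeasurableSet E ∧ μ E = 0 ∧
      pw E (followPath φ P m') (followPath φ P m) = followPath φ P m' := by
  rw [← hPμ] at h
  obtain ⟨Z, hZ, hZm, hZ0⟩ := exists_measurable_superset_of_null (ae_iff.1 h)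
  refine ⟨P ⁻¹' Z, hP hZm, by rwa [← Measure.map_apply hP hZm], funext fun s => ?_⟩
  by_cases hs : s ∈ P ⁻¹' Z
  · exact pw_of_mem hs
  · rw [pw_of_notMem hs]
    have : m (P s) = m' (P s) := by
      by_contra hne
      exact hs (hZ hne)
    simp only [followPath, this]

lemma IsDecompSeqClosedGraph.isMonotoneSelection [TopologicalSpace T] [Nonempty S]
    {F : Set (S → T)} {B : (S → T) → Set (S → T)} (hB : IsDecompSeqClosedGraph μ F B)
    (hP : Measurable P) (hPμ : μ.map P = volume.restrict (Set.Icc 0 1)) {K : Set ℝ}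
    (hK : IsCompact K) (hφ : ContinuousOn φ K)
    (hne : ∃ m, Monotone m ∧ (∀ x, m x ∈ K) ∧ followPath φ P m ∈ F)
    (hBne : ∀ m, Monotone m → (∀ x, m x ∈ K) → followPath φ P m ∈ F →
      ∃ b, Monotone b ∧ (∀ x, b x ∈ K) ∧ followPath φ P b ∈ B (followPath φ P m)) :
    IsMonotoneSelection K {m | Monotone m ∧ (∀ x, m x ∈ K) ∧ followPath φ P m ∈ F}
      fun m b => Monotone b ∧ (∀ x, b x ∈ K) ∧ followPath φ P b ∈ B (followPath φ P m) where
  compact := hK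
  nonempty := hne
  mono m hm := hm.1
  mem m hm := hm.2.1
  closed u m hu hum := ⟨monotone_of_tendsto_pointwise (fun n => (hu n).1) hum,
    fun x => hK.isClosed.mem_of_tendsto (hum x) (Eventually.of_forall fun n => (hu n).2.1 x),
    hB.seqClosed_dom (fun n => (hu n).2.2)
      (tendsto_followPath hK.isClosed hφ P (fun n => (hu n).2.1) hum)⟩
  switch D hD hDM h hh hcover := ⟨hh, fun x => by
      obtain ⟨b, hb, hx⟩ := hcover x
      exact hx ▸ (hDM hb).2.1 x,
    hB.decomp_dom.followPath_mem hP hD (fun b hb => (hDM hb).1) (fun b hb => (hDM hb).2.2) hh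
      hcover⟩
  rel_mem m hm b hb := ⟨hb.1, hb.2.1, hB.maps_into _ hm.2.2 hb.2.2⟩
  exists_rel m hm := hBne m hm.1 hm.2.1 hm.2.2
  rel_switch m hm D hD hDR h hh hcover := ⟨hh, fun x => by
      obtain ⟨b, hb, hx⟩ := hcover x
      exact hx ▸ (hDR b hb).2.1 x,
    (hB.decomp_val _ hm.2.2).followPath_mem hP hD (fun b hb => (hDR b hb).1)
      (fun b hb => (hDR b hb).2.2) hh hcover⟩
  rel_closed u v m b hu huv hum hvb := by
    have hm := tendsto_followPath hK.isClosed hφ P (fun n => (hu n).2.1) hum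
    have hb := tendsto_followPath hK.isClosed hφ P (fun n => (huv n).2.1) hvb
    exact ⟨monotone_of_tendsto_pointwise (fun n => (huv n).1) hvb,
      fun x => hK.isClosed.mem_of_tendsto (hvb x) (Eventually.of_forall fun n => (huv n).2.1 x),
      hB.seqClosed_graph _ _ _ _ (fun n => (hu n).2.2) (fun n => (huv n).2.2) hm hb
        (hB.seqClosed_dom (fun n => (hu n).2.2) hm)
        (hB.seqClosed_dom (fun n => hB.maps_into _ (hu n).2.2 (huv n).2.2) hb)⟩
  rel_congr m hm m' hm' b b' hb' hmb hmm' hbb' := by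
    refine ⟨hb'.1, hb'.2.1, ?_⟩
    obtain ⟨E, hE, hE0, hEm⟩ := exists_null_pw_followPath (φ := φ) hP hPμ hmm'
    obtain ⟨E', hE', hE0', hEb⟩ := exists_null_pw_followPath (φ := φ) hP hPμ hbb'
    have h1 := (hB.null_modification E hE hE0 _ hm.2.2 _ hmb.2.2 _ hm'.2.2).2
    rw [hEm] at h1
    have h2 := (hB.null_modification E' hE' hE0' _ hm'.2.2 _ h1 _ hb'.2.2).1
    rwa [hEb] at h2

/-- A nonempty compact metrizable set is the continuous image of a compact set of reals. -/
lemma IsCompact.exists_image_eq {α : Type*} [TopologicalSpace α] {X : Set α} (hX : IsCompact X)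
    (hXm : TopologicalSpace.MetrizableSpace X) (hne : X.Nonempty) :
    ∃ (K : Set ℝ) (φ : ℝ → α), IsCompact K ∧ ContinuousOn φ K ∧ φ '' K = X := by
  have := hne.to_subtype
  have := isCompact_iff_compactSpace.1 hX
  let _ := TopologicalSpace.metrizableSpaceMetric X
  obtain ⟨f, hf, hfs⟩ := exists_nat_bool_continuous_surjective_of_compact X
  let g : cantorSet → α := fun x => f (cantorSetHomeomorphNatToBool x)
  have hg : Continuous g :=
    continuous_subtype_val.comp (hf.comp cantorSetHomeomorphNatToBool.continuous)
  have hext : ∀ x : cantorSet, Function.extend Subtype.val g (fun _ => hne.some) x = g x := fun x =>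
    Subtype.val_injective.extend_apply _ _ x
  refine ⟨cantorSet, Function.extend Subtype.val g fun _ => hne.some, isCompact_cantorSet, ?_, ?_⟩
  · rw [continuousOn_iff_continuous_domRestrict]
    convert hg using 1
    exact funext hext
  · ext y
    constructor
    · rintro ⟨x, hx, rfl⟩
      rw [hext ⟨x, hx⟩]
      exact (f _).2
    · intro hy
      obtain ⟨z, hz⟩ := hfs ⟨y, hy⟩
      obtain ⟨x, rfl⟩ := cantorSetHomeomorphNatToBool.surjective z
      exact ⟨x, x.2, by rw [hext x]; exact congrArg Subtype.val hz⟩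

end Selection

/-- Every compact metrizable set `X` of functions (topology of pointwise convergence)
is contained in a sequentially compact set `Y` having the μ-fixed point property. -/
theorem stmt0 {S T : Type*} [MeasurableSpace S] [TopologicalSpace T] [Nonempty T]
    (μ : Measure S) [IsProbabilityMeasure μ] (hμ : MeasureAtomless μ)
    (X : Set (S → T)) (hXcompact : IsCompact X)
    (hXmetr : TopologicalSpace.MetrizableSpace X) :
    ∃ Y : Set (S → T), X ⊆ Y ∧ IsSeqCompact Y ∧ HasMuFixedPointProperty μ Y := by
  rcases X.eq_empty_or_nonempty with rfl | hne
  · refine ⟨∅, subset_rfl, fun u hu => (hu 0).elim, fun F B _ h => ?_⟩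
    simp at h
  have := nonempty_of_isProbabilityMeasure μ
  obtain ⟨P, hP, hPμ⟩ := hμ.exists_uniform
  obtain ⟨K, φ, hK, hφ, hKX⟩ := hXcompact.exists_image_eq hXmetr hne
  refine ⟨followPath φ P '' {m | Monotone m ∧ ∀ x, m x ∈ K}, ?_, ?_, ?_⟩
  · rw [← hKX]
    rintro _ ⟨k, hk, rfl⟩
    exact ⟨fun _ => k, ⟨monotone_const, fun _ => hk⟩, rfl⟩
  · intro y hy
    choose u hu huy using hy
    obtain ⟨ψ, hψ, v, hv⟩ := hK.exists_subseq_tendsto_of_monotone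
      (fun n (_ : Unit) => u n) (fun n _ => (hu n).1) (fun n _ => (hu n).2)
    replace hv := hv ()
    refine ⟨followPath φ P (v ()), ⟨v (), ⟨monotone_of_tendsto_pointwise
      (fun n => (hu (ψ n)).1) hv, fun x => hK.isClosed.mem_of_tendsto (hv x)
        (Eventually.of_forall fun n => (hu (ψ n)).2 x)⟩, rfl⟩, ψ, hψ, ?_⟩
    convert tendsto_followPath hK.isClosed hφ P (fun n => (hu (ψ n)).2) hv using 2 with n
    exact (huy (ψ n)).symm
  · rintro F B hB ⟨_, ⟨m, hm, rfl⟩, hmF⟩ hBne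
    obtain ⟨b, hb, hbb⟩ := (hB.isMonotoneSelection hP hPμ hK hφ ⟨m, hm.1, hm.2, hmF⟩
      fun m h1 h2 h3 => by
        obtain ⟨_, ⟨b, hb, rfl⟩, hbm⟩ := hBne _ ⟨⟨m, ⟨h1, h2⟩, rfl⟩, h3⟩
        exact ⟨b, hb.1, hb.2, hbm⟩).exists_fixed_point
    exact ⟨_, ⟨⟨b, ⟨hb.1, hb.2.1⟩, rfl⟩, hb.2.2⟩, hbb.2.2⟩
end

section
/- Let (S,Σ,μ) be an atomless probability space, T a nonempty topological space, and X ⊆ L(S,T) compact and metrizable in the topology of pointwise convergence. Then there exists a function θ: L([0,1],C) → L(S,T) such that: (1) θ is sequentially pointwise continuous; (2) θ maps the set of constant functions in L([0,1],C) onto X; (3) if D ⊆ L(S,T) is decomposable, then θ⁻¹(D) is a decomposable subset of L([0,1],C); (4) if f,g ∈ L([0,1],C) differ on at most a countable set of points of [0,1], then θ(f) and θ(g) differ only on a set of μ-measure zero. -/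
open MeasureTheory Topology Filter

/-- A set `D ⊆ L([0,1], C)` of Cantor-set valued functions on the unit interval is
decomposable if it is stable under decompositions along Borel sets `E ⊆ [0,1]`. -/
def DecomposableC (D : Set (unitInterval → cantorSet)) : Prop :=
  ∀ f ∈ D, ∀ g ∈ D, ∀ E : Set unitInterval, MeasurableSet E → pw E g f ∈ D

/-- In an atomless finite measure space, sets of positive measure contain measurable subsets
of arbitrarily small positive measure. -/
theorem MeasureAtomless.exists_subset_measure_le {S : Type*} [MeasurableSpace S] {μ : Measure S}
    [IsFiniteMeasure μ] (hμ : MeasureAtomless μ) {E : Set S} (hE : MeasurableSet E)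
    (hpos : 0 < μ E) {ε : ENNReal} (hε : ε ≠ 0) :
    ∃ F ⊆ E, MeasurableSet F ∧ 0 < μ F ∧ μ F ≤ ε := by
  have halving : ∀ n : ℕ, ∃ F ⊆ E, MeasurableSet F ∧ 0 < μ F ∧ 2 ^ n * μ F ≤ μ E := by
    intro n
    induction n with
    | zero => exact ⟨E, subset_rfl, hE, hpos, by simp⟩
    | succ n ih =>
      obtain ⟨F, hFE, hF, hF0, hFn⟩ := ih
      obtain ⟨G, hGF, hG, hG0, hGlt⟩ := hμ F hF hF0
      have hadd : μ G + μ (F \ G) = μ F := by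
        rw [← measure_inter_add_sdiff F hG, Set.inter_eq_self_of_subset_right hGF]
      rcases le_total (μ G) (μ (F \ G)) with h | h
      · refine ⟨G, hGF.trans hFE, hG, hG0, le_trans ?_ hFn⟩
        rw [pow_succ, mul_assoc, two_mul, ← hadd]
        gcongr
      · refine ⟨F \ G, Set.sdiff_subset.trans hFE, hF.diff hG, ?_, le_trans ?_ hFn⟩
        · refine pos_iff_ne_zero.2 fun h0 => hGlt.ne ?_
          rw [← hadd, h0, add_zero]
        · rw [pow_succ, mul_assoc, two_mul, ← hadd]
          gcongr
  obtain ⟨n, hn⟩ := ENNReal.exists_nat_mul_gt hε (measure_ne_top μ E)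
  obtain ⟨F, hFE, hF, hF0, hFn⟩ := halving n
  refine ⟨F, hFE, hF, hF0, ?_⟩
  by_contra! h
  have hle : (n : ENNReal) * ε ≤ 2 ^ n * μ F := by
    gcongr
    exact_mod_cast n.lt_two_pow_self.le
  exact absurd (hn.trans_le (hle.trans hFn)) (lt_irrefl _)

/-- An atomless finite measure space is covered, up to a null set, by countably many measurable
sets of small measure. -/
theorem MeasureAtomless.exists_seq_ae_cover {S : Type*} [MeasurableSpace S] {μ : Measure S}
    [IsFiniteMeasure μ] (hμ : MeasureAtomless μ) {ε : ENNReal} (hε : ε ≠ 0) :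
    ∃ A : ℕ → Set S, (∀ n, MeasurableSet (A n) ∧ μ (A n) ≤ ε) ∧ μ (⋃ n, A n)ᶜ = 0 := by
  let P : Set (ℕ → Set S) := {A | ∀ n, MeasurableSet (A n) ∧ μ (A n) ≤ ε}
  let V : Set ENNReal := (fun A : ℕ → Set S => μ (⋃ n, A n)) '' P
  have hV : V.Nonempty := ⟨_, fun _ => ∅, fun n => by simp, rfl⟩
  obtain ⟨u, -, hu, huV⟩ := exists_seq_tendsto_sSup hV (OrderTop.bddAbove V)
  choose A hAP hAu using huV
  let B : ℕ → Set S := fun n => A n.unpair.1 n.unpair.2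
  have hB : B ∈ P := fun n => hAP _ _
  refine ⟨B, hB, ?_⟩
  have hsup : sSup V ≤ μ (⋃ n, B n) := by
    refine le_of_tendsto' hu fun k => ?_
    rw [← hAu k]
    refine measure_mono (Set.iUnion_subset fun i => ?_)
    have hki : A k i = B (Nat.pair k i) := by simp [B]
    exact hki ▸ Set.subset_iUnion B _
  by_contra h
  have hBm : MeasurableSet (⋃ n, B n) := .iUnion fun n => (hB n).1
  obtain ⟨F, hFsub, hF, hF0, hFε⟩ :=
    hμ.exists_subset_measure_le hBm.compl (pos_iff_ne_zero.2 h) hε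
  let B' : ℕ → Set S := fun n => n.casesOn F B
  have hB' : B' ∈ P := by
    rintro (_ | n)
    exacts [⟨hF, hFε⟩, hB n]
  have hle : μ (F ∪ ⋃ n, B n) ≤ sSup V := by
    refine le_trans (measure_mono ?_) (le_sSup ⟨B', hB', rfl⟩)
    exact Set.union_subset (Set.subset_iUnion B' 0)
      (Set.iUnion_subset fun n => Set.subset_iUnion B' (n + 1))
  rw [measure_union (Set.disjoint_left.2 fun x hx => hFsub hx) hBm, add_comm] at hle
  exact absurd (hle.trans hsup) (ENNReal.lt_add_right (measure_ne_top μ _) hF0.ne').not_ge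

/-- An atomless finite measure space admits a measurable map to the unit interval with null
fibres. -/
theorem MeasureAtomless.exists_measurable_null_fibers {S : Type*} [MeasurableSpace S]
    {μ : Measure S} [IsFiniteMeasure μ] (hμ : MeasureAtomless μ) :
    ∃ p : S → unitInterval, Measurable p ∧ ∀ a, μ (p ⁻¹' {a}) = 0 := by
  classical
  have hε (n : ℕ) : ((n : ENNReal) + 1)⁻¹ ≠ 0 := by simp
  choose A hA hcover using fun n => hμ.exists_seq_ae_cover (hε n)
  let q : S → ℕ → Bool := fun s k => decide (s ∈ A k.unpair.1 k.unpair.2)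
  have hq : Measurable q := by
    refine measurable_pi_lambda _ fun k => measurable_to_bool ?_
    simpa [q, Set.preimage] using (hA k.unpair.1 k.unpair.2).1
  let e : (ℕ → Bool) → unitInterval := fun b =>
    Set.inclusion cantorSet_subset_unitInterval (cantorSetHomeomorphNatToBool.symm b)
  have he : Continuous e :=
    (continuous_inclusion cantorSet_subset_unitInterval).comp
      cantorSetHomeomorphNatToBool.symm.continuous
  have he_inj : Function.Injective e :=
    (Set.inclusion_injective cantorSet_subset_unitInterval).comp
      cantorSetHomeomorphNatToBool.symm.injective
  refine ⟨e ∘ q, he.measurable.comp hq, fun a => ?_⟩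
  by_cases hN : (e ∘ q) ⁻¹' {a} ⊆ ⋃ n, (⋃ i, A n i)ᶜ
  · exact measure_mono_null hN (measure_iUnion_null hcover)
  obtain ⟨s, hs, hsN⟩ := Set.not_subset.1 hN
  simp only [Set.mem_iUnion, Set.mem_compl_iff, not_exists, not_not, not_forall] at hsN
  have hsmall (n : ℕ) : μ ((e ∘ q) ⁻¹' {a}) ≤ ((n : ENNReal) + 1)⁻¹ := by
    obtain ⟨i, hi⟩ := hsN n
    refine (measure_mono fun t ht => ?_).trans (hA n i).2
    have hqst : q t = q s := he_inj (ht.trans hs.symm)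
    have := congrFun hqst (Nat.pair n i)
    simpa [q, hi] using this
  by_contra h
  obtain ⟨n, hn⟩ := ENNReal.exists_inv_nat_lt h
  refine absurd ((hsmall n).trans (ENNReal.inv_le_inv.2 ?_)) hn.not_ge
  exact le_self_add

/-- For a nonempty compact metrizable `X ⊆ L(S,T)` (pointwise topology) there exists
`θ : L([0,1],C) → L(S,T)` which is sequentially pointwise continuous, maps the
constant functions onto `X`, pulls decomposable sets back to decomposable sets, and
identifies (up to μ-null sets) functions differing on countable sets. -/
theorem stmt3 {S T : Type*} [MeasurableSpace S] [TopologicalSpace T] [Nonempty T]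
    (μ : Measure S) [IsProbabilityMeasure μ] (hμ : MeasureAtomless μ)
    (X : Set (S → T)) (hXne : X.Nonempty) (hXcompact : IsCompact X)
    (hXmetr : TopologicalSpace.MetrizableSpace X) :
    ∃ θ : (unitInterval → cantorSet) → (S → T),
      (∀ (u : ℕ → unitInterval → cantorSet) (f : unitInterval → cantorSet),
        Tendsto u atTop (𝓝 f) → Tendsto (fun n => θ (u n)) atTop (𝓝 (θ f))) ∧
      (θ '' {f | ∃ c, f = fun _ => c} = X) ∧
      (∀ D : Set (S → T), Decomposable D → DecomposableC (θ ⁻¹' D)) ∧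
      (∀ f g : unitInterval → cantorSet,
        {a | f a ≠ g a}.Countable → μ {s | θ f s ≠ θ g s} = 0) := by
  have : Nonempty X := hXne.to_subtype
  have : CompactSpace X := isCompact_iff_compactSpace.1 hXcompact
  let : MetricSpace X := TopologicalSpace.metrizableSpaceMetric X
  obtain ⟨ψ, hψ, hψsurj⟩ := exists_nat_bool_continuous_surjective_of_compact X
  let φ : cantorSet → S → T := fun c => ψ (cantorSetHomeomorphNatToBool c)
  have hφ : Continuous φ :=
    continuous_subtype_val.comp (hψ.comp cantorSetHomeomorphNatToBool.continuous)
  obtain ⟨p, hp, hp0⟩ := hμ.exists_measurable_null_fibers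
  refine ⟨fun f s => φ (f (p s)) s, ?_, ?_, ?_, ?_⟩
  · intro u f hu
    rw [tendsto_pi_nhds] at hu ⊢
    intro s
    exact (((continuous_apply s).comp hφ).tendsto _).comp (hu (p s))
  · ext x
    constructor
    · rintro ⟨_, ⟨c, rfl⟩, rfl⟩
      exact (ψ (cantorSetHomeomorphNatToBool c)).2
    · intro hx
      obtain ⟨b, hb⟩ := hψsurj ⟨x, hx⟩
      refine ⟨_, ⟨cantorSetHomeomorphNatToBool.symm b, rfl⟩, ?_⟩
      simp [φ, hb]
  · intro D hD f hf g hg E hE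
    have := hD _ hf _ hg (p ⁻¹' E) (hp hE)
    rw [Set.mem_preimage]
    convert this using 1
    ext s
    by_cases h : p s ∈ E <;> simp [pw, h]
  · intro f g hfg
    refine measure_mono_null (t := p ⁻¹' {a | f a ≠ g a}) (fun s hs h => hs ?_) ?_
    · exact congrArg (fun c => φ c s) h
    · rw [← Set.biUnion_preimage_singleton]
      exact (measure_biUnion_null_iff hfg).2 fun a _ => hp0 a
end

section
/- Let (S,Σ,μ) be an atomless probability space, T a nonempty topological space, X ⊆ L(S,T) compact and metrizable in the pointwise topology, and let θ: L([0,1],C) → L(S,T) satisfy: θ is sequentially pointwise continuous; θ maps the constant functions onto X; θ⁻¹ of any decomposable subset of L(S,T) is decomposable; and θ identifies (up to μ-null sets) functions differing on countable sets. Let M be the set of monotone (nondecreasing) functions from [0,1] to C, and set Y = θ(M). Let B: F ⇉ F be a decomposable μ-sequentially closed-graphed mapping with Y∩F ≠ ∅ and Y∩B(f) ≠ ∅ for all f ∈ Y∩F. Define 𝓕 = θ⁻¹(F) and, for f ∈ 𝓕, P(f) = θ⁻¹(B(θ(f))). Then: (1) 𝓕 is sequentially closed, decomposable, and M∩𝓕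 ≠ ∅; (2) for each f ∈ 𝓕, P(f) is sequentially closed and decomposable; (3) P has a sequentially closed graph in 𝓕×𝓕; (4) if E ⊆ [0,1] is countable and g ∈ P(f), then h_E g ∈ P(f) and g ∈ P(h_E f) for all h ∈ 𝓕; (5) for any f ∈ M∩𝓕, the set P(f)∩M is nonempty; (6) if f ∈ P(f), then θ(f) ∈ B(θ(f)). -/
open MeasureTheory Topology Filter

theorem pw_eq_of_ne_subset {α β : Type*} {E : Set α} {f g : α → β}
    (h : {a | f a ≠ g a} ⊆ E) : pw E f g = f := by
  classical
  funext a
  by_cases ha : a ∈ E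
  · simp [pw, Set.piecewise, ha]
  · have : f a = g a := by_contra fun hne => ha (h hne)
    simp [pw, Set.piecewise, ha, this]

theorem ne_pw_subset {α β : Type*} (E : Set α) (g f : α → β) :
    {a | pw E g f a ≠ f a} ⊆ E := by
  classical
  intro a ha
  by_contra haE
  exact ha (by simp [pw, Set.piecewise, haE])

/-- Stability of a decomposable μ-sequentially closed-graphed mapping under modifications on
sets of outer measure zero, which need not be measurable. -/
theorem IsDecompSeqClosedGraph.mem_of_null_ne {S T : Type*} [MeasurableSpace S]
    [TopologicalSpace T] {μ : Measure S} {F : Set (S → T)} {B : (S → T) → Set (S → T)}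
    (hB : IsDecompSeqClosedGraph μ F B) {f g k : S → T} (hf : f ∈ F) (hg : g ∈ B f) (hk : k ∈ F) :
    (μ {s | k s ≠ g s} = 0 → k ∈ B f) ∧ (μ {s | k s ≠ f s} = 0 → g ∈ B k) := by
  constructor <;> intro h0
  · have := (hB.null_modification _ (measurableSet_toMeasurable μ _)
      ((measure_toMeasurable _).trans h0) f hf g hg k hk).1
    rwa [pw_eq_of_ne_subset (subset_toMeasurable μ _)] at this
  · have := (hB.null_modification _ (measurableSet_toMeasurable μ _)
      ((measure_toMeasurable _).trans h0) f hf g hg k hk).2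
    rwa [pw_eq_of_ne_subset (subset_toMeasurable μ _)] at this

/-- Properties of the pulled-back correspondence `P f = θ⁻¹ (B (θ f))` on
`𝓕 = θ⁻¹ F`, where `θ` has the properties of Lemma 2 (sequential pointwise
continuity, mapping constants onto `X`, pulling back decomposable sets to
decomposable sets, identifying functions differing on countable sets up to μ-null
sets), `M` is the set of monotone functions `[0,1] → C` and `Y = θ '' M`. -/
theorem stmt5 {S T : Type*} [MeasurableSpace S] [TopologicalSpace T] [Nonempty T]
    (μ : Measure S) [IsProbabilityMeasure μ] (hμ : MeasureAtomless μ)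
    (X : Set (S → T)) (hXcompact : IsCompact X)
    (hXmetr : TopologicalSpace.MetrizableSpace X)
    (θ : (unitInterval → cantorSet) → (S → T))
    (hθ1 : ∀ (u : ℕ → unitInterval → cantorSet) (f : unitInterval → cantorSet),
      Tendsto u atTop (𝓝 f) → Tendsto (fun n => θ (u n)) atTop (𝓝 (θ f)))
    (hθ2 : θ '' {f | ∃ c, f = fun _ => c} = X)
    (hθ3 : ∀ D : Set (S → T), Decomposable D → DecomposableC (θ ⁻¹' D))
    (hθ4 : ∀ f g : unitInterval → cantorSet,
      {a | f a ≠ g a}.Countable → μ {s | θ f s ≠ θ g s} = 0)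
    (M : Set (unitInterval → cantorSet)) (hM : M = {f | Monotone f})
    (Y : Set (S → T)) (hY : Y = θ '' M)
    (F : Set (S → T)) (B : (S → T) → Set (S → T))
    (hB : IsDecompSeqClosedGraph μ F B)
    (hYF : (Y ∩ F).Nonempty)
    (hYB : ∀ f ∈ Y ∩ F, (Y ∩ B f).Nonempty)
    (𝓕 : Set (unitInterval → cantorSet)) (h𝓕 : 𝓕 = θ ⁻¹' F)
    (P : (unitInterval → cantorSet) → Set (unitInterval → cantorSet))
    (hP : ∀ f, P f = θ ⁻¹' B (θ f)) :
    (IsSeqClosed 𝓕 ∧ DecomposableC 𝓕 ∧ (M ∩ 𝓕).Nonempty) ∧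
    (∀ f ∈ 𝓕, IsSeqClosed (P f) ∧ DecomposableC (P f)) ∧
    (∀ (u v : ℕ → unitInterval → cantorSet) (f g : unitInterval → cantorSet),
      (∀ n, u n ∈ 𝓕) → (∀ n, v n ∈ P (u n)) →
      Tendsto u atTop (𝓝 f) → Tendsto v atTop (𝓝 g) →
      f ∈ 𝓕 → g ∈ 𝓕 → g ∈ P f) ∧
    (∀ E : Set unitInterval, E.Countable → ∀ f ∈ 𝓕, ∀ g ∈ P f, ∀ h ∈ 𝓕,
      pw E h g ∈ P f ∧ g ∈ P (pw E h f)) ∧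
    (∀ f ∈ M ∩ 𝓕, (P f ∩ M).Nonempty) ∧
    (∀ f, f ∈ P f → θ f ∈ B (θ f)) := by
  subst hM hY h𝓕
  obtain rfl : P = fun f => θ ⁻¹' B (θ f) := funext hP
  have hdec := hθ3 F hB.decomp_dom
  refine ⟨⟨?_, hdec, ?_⟩, ?_, ?_, ?_, ?_, fun f hf => hf⟩
  · intro u f hu huf
    exact hB.seqClosed_dom hu (hθ1 u f huf)
  · obtain ⟨_, ⟨m, hm, rfl⟩, hmF⟩ := hYF
    exact ⟨m, hm, hmF⟩
  · intro f hf
    refine ⟨?_, hθ3 _ (hB.decomp_val _ hf)⟩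
    intro v g hv hvg
    have hθv := hθ1 v g hvg
    exact hB.seqClosed_graph (fun _ => θ f) (fun n => θ (v n)) _ _ (fun _ => hf) hv
      tendsto_const_nhds hθv hf
      (hB.seqClosed_dom (fun n => hB.maps_into _ hf (hv n)) hθv)
  · intro u v f g hu hv huf hvg hf hg
    exact hB.seqClosed_graph _ _ _ _ hu hv (hθ1 u f huf) (hθ1 v g hvg) hf hg
  · intro E hE f hf g hg h hh
    have hnull : ∀ k, μ {s | θ (pw E h k) s ≠ θ k s} = 0 := fun k =>
      hθ4 _ _ (hE.mono (ne_pw_subset E h k))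
    have hmem : ∀ k ∈ θ ⁻¹' F, pw E h k ∈ θ ⁻¹' F := fun k hk =>
      hdec k hk h hh E hE.measurableSet
    exact ⟨(hB.mem_of_null_ne hf hg (hmem g (hB.maps_into _ hf hg))).1 (hnull g),
      (hB.mem_of_null_ne hf hg (hmem f hf)).2 (hnull f)⟩
  · rintro f ⟨hfM, hfF⟩
    obtain ⟨_, ⟨m, hm, rfl⟩, hmB⟩ := hYB (θ f) ⟨⟨f, hfM, rfl⟩, hfF⟩
    exact ⟨m, hmB, hm⟩
end
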